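/- Under Assumptions (A) and (B), as n → ∞, the normalized log-determinant (log det(Y Yᵀ) − μ_n)/σ_n converges in distribution to a standard normal random variable N(0,1), where μ_n = log tr(AAᵀ) − p log n − σ_n²/2 + ∑_{i=1}^{p−1} log(∑_{k=1}^n λ_k(AAᵀ) t_{i,k}(A)) and σ_n² = −2p/n + 2 ∑_{i=1}^{p−1} (∑_{k=1}^n λ_k(AAᵀ)² t_{i,k}(A)) / (∑_{k=1}^n λ_k(AAᵀ) t_{i,k}(A))². -/

import Mathlib

open MeasureTheory ProbabilityTheory Matrix Filter Topology

noncomputable section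

/-- The standard Gaussian measure on `ℝ^d` (modeled on `Fin d → ℝ`). -/
def gaussianPi (d : ℕ) : Measure (Fin d → ℝ) :=
  Measure.pi fun _ => gaussianReal 0 1

/-- The Euclidean norm on `Fin n → ℝ`. -/
def euclidNorm {n : ℕ} (x : Fin n → ℝ) : ℝ :=
  Real.sqrt (∑ j, x j ^ 2)

/-- The uniform distribution on the unit sphere `S^{n-1} ⊆ ℝ^n`, realized as the law of a
normalized standard Gaussian vector. -/
def uniformSphere (n : ℕ) : Measure (Fin n → ℝ) :=
  (gaussianPi n).map fun x => (euclidNorm x)⁻¹ • x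

/-- `lam` is the (decreasingly) ordered enumeration of the eigenvalues of the symmetric
matrix `M`. -/
def IsOrderedEigenvalues {n : ℕ} (M : Matrix (Fin n) (Fin n) ℝ) (lam : Fin n → ℝ) : Prop :=
  Antitone lam ∧ ∃ (hM : M.IsHermitian) (σ : Equiv.Perm (Fin n)), lam = hM.eigenvalues ∘ σ

/-- The quantity `t_{i,k}(A)`, expressed in terms of the eigenvalues `lam` of `AAᵀ`:
`t_{i,k} = E[1/(1 + λ_k w_{ik}ᵀ (∑_{ℓ≠k} λ_ℓ w_{iℓ} w_{iℓ}ᵀ)⁻¹ w_{ik})]`, where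
`w_{i1},…,w_{in}` are i.i.d. standard Gaussian vectors in `ℝ^i`. -/
def tval (i : ℕ) {n : ℕ} (lam : Fin n → ℝ) (k : Fin n) : ℝ :=
  ∫ w : Fin n → Fin i → ℝ,
    (1 + lam k *
        (w k ⬝ᵥ ((∑ l ∈ Finset.univ.erase k,
            lam l • Matrix.vecMulVec (w l) (w l))⁻¹).mulVec (w k)))⁻¹
    ∂(Measure.pi fun _ : Fin n => gaussianPi i)

/-- The variance `σ_n²` from Theorem 2.1:
`σ_n² = −2p/n + 2 ∑_{i=1}^{p−1} (∑_k λ_k² t_{i,k})/(∑_k λ_k t_{i,k})²`. -/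
def sigmaSq (n p : ℕ) (lam : Fin n → ℝ) : ℝ :=
  -2 * (p : ℝ) / (n : ℝ) + 2 * ∑ i ∈ Finset.Ico 1 p,
    (∑ k, lam k ^ 2 * tval i lam k) / (∑ k, lam k * tval i lam k) ^ 2

/-- The centering `μ_n` from Theorem 2.1:
`μ_n = log tr(AAᵀ) − p log n − σ_n²/2 + ∑_{i=1}^{p−1} log(∑_k λ_k t_{i,k})`. -/
def muSeq (n p : ℕ) (A : Matrix (Fin n) (Fin n) ℝ) (lam : Fin n → ℝ) : ℝ :=
  Real.log (Matrix.trace (A * Aᵀ)) - (p : ℝ) * Real.log (n : ℝ) - sigmaSq n p lam / 2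
    + ∑ i ∈ Finset.Ico 1 p, Real.log (∑ k, lam k * tval i lam k)

end

noncomputable section

/-- `log det(YYᵀ)` for the matrix `Y = (A u_1, …, A u_p)ᵀ`. -/
def logDetYY (n p : ℕ) (A : Matrix (Fin n) (Fin n) ℝ) (ω : Fin p → Fin n → ℝ) : ℝ :=
  Real.log
    (Matrix.det (Matrix.of (fun i => A.mulVec (ω i)) * (Matrix.of (fun i => A.mulVec (ω i)))ᵀ))

end

/-- The weighted sum of rank one matrices. -/
noncomputable def Bm {n i : ℕ} (lam : Fin n → ℝ) (w : Fin n → Fin i → ℝ) :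
    Matrix (Fin i) (Fin i) ℝ := ∑ l, lam l • Matrix.vecMulVec (w l) (w l)

/-- Leverage kernel. -/
noncomputable def av {n i : ℕ} (lam : Fin n → ℝ) (w : Fin n → Fin i → ℝ) (k l : Fin n) : ℝ :=
  w k ⬝ᵥ ((Bm lam w)⁻¹ *ᵥ w l)

/-- Spanning condition. -/
def Sp {n i : ℕ} (w : Fin n → Fin i → ℝ) : Prop :=
  ∀ x : Fin i → ℝ, (∀ l, w l ⬝ᵥ x = 0) → x = 0

lemma sumVec_quad {n i : ℕ} (s : Finset (Fin n)) (lam : Fin n → ℝ) (w : Fin n → Fin i → ℝ)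
    (x y : Fin i → ℝ) :
    x ⬝ᵥ ((∑ l ∈ s, lam l • Matrix.vecMulVec (w l) (w l)) *ᵥ y) =
      ∑ l ∈ s, lam l * ((w l ⬝ᵥ x) * (w l ⬝ᵥ y)) := by
  rw [Matrix.sum_mulVec, dotProduct_sum]
  refine Finset.sum_congr rfl fun l _ => ?_
  rw [Matrix.smul_mulVec, Matrix.vecMulVec_mulVec, dotProduct_smul, dotProduct_comm x]
  simp [mul_comm]

lemma sumVec_posDef {n i : ℕ} (s : Finset (Fin n)) (lam : Fin n → ℝ) (hl : ∀ k, 0 < lam k)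
    (w : Fin n → Fin i → ℝ) (hw : ∀ x : Fin i → ℝ, (∀ l ∈ s, w l ⬝ᵥ x = 0) → x = 0) :
    (∑ l ∈ s, lam l • Matrix.vecMulVec (w l) (w l)).PosDef := by
  refine Matrix.PosDef.of_dotProduct_mulVec_pos ?_ ?_
  · unfold Matrix.IsHermitian
    rw [conjTranspose_sum]
    refine Finset.sum_congr rfl fun l _ => ?_
    ext a b
    simp [Matrix.vecMulVec_apply, mul_comm]
  · intro x hx
    rw [star_trivial, sumVec_quad]
    have h0 : ∀ l ∈ s, 0 ≤ lam l * ((w l ⬝ᵥ x) * (w l ⬝ᵥ x)) := fun l _ =>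
      mul_nonneg (hl l).le (mul_self_nonneg _)
    refine lt_of_le_of_ne (Finset.sum_nonneg h0) fun h => hx ?_
    refine hw x fun l hls => ?_
    have := (Finset.sum_eq_zero_iff_of_nonneg h0).1 h.symm l hls
    simpa [(hl l).ne'] using this

lemma Bm_posDef {n i : ℕ} {lam : Fin n → ℝ} (hl : ∀ k, 0 < lam k)
    {w : Fin n → Fin i → ℝ} (hw : Sp w) : (Bm lam w).PosDef :=
  sumVec_posDef Finset.univ lam hl w fun x hx => hw x fun l => hx l (Finset.mem_univ l)

lemma Bm_quad {n i : ℕ} (lam : Fin n → ℝ) (w : Fin n → Fin i → ℝ) (x y : Fin i → ℝ) :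
    x ⬝ᵥ (Bm lam w *ᵥ y) = ∑ l, lam l * ((w l ⬝ᵥ x) * (w l ⬝ᵥ y)) :=
  sumVec_quad Finset.univ lam w x y

section
variable {n i : ℕ} {lam kap : Fin n → ℝ} {w : Fin n → Fin i → ℝ}

lemma Bm_inv_symm (hl : ∀ k, 0 < lam k) (hw : Sp w) (x y : Fin i → ℝ) :
    x ⬝ᵥ ((Bm lam w)⁻¹ *ᵥ y) = y ⬝ᵥ ((Bm lam w)⁻¹ *ᵥ x) := by
  have h := (Bm_posDef hl hw).inv.isHermitian
  have ht : ((Bm lam w)⁻¹)ᵀ = (Bm lam w)⁻¹ := by simpa [Matrix.IsHermitian] using h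
  rw [dotProduct_comm, ← ht, Matrix.mulVec_transpose, ← Matrix.dotProduct_mulVec, ht]

lemma av_symm (hl : ∀ k, 0 < lam k) (hw : Sp w) (k l : Fin n) : av lam w k l = av lam w l k :=
  Bm_inv_symm hl hw _ _

lemma Bm_isUnit (hl : ∀ k, 0 < lam k) (hw : Sp w) : IsUnit (Bm lam w).det :=
  (Bm_posDef hl hw).det_pos.ne'.isUnit

lemma av_sum_mul (hl : ∀ k, 0 < lam k) (hk : ∀ k, 0 < kap k) (hw : Sp w) (k l : Fin n)
    (d : Fin n → ℝ) :
    ∑ m, d m * (av lam w k m * av kap w m l) =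
      w k ⬝ᵥ (((Bm lam w)⁻¹ * Bm d w * (Bm kap w)⁻¹) *ᵥ w l) := by
  have h := Bm_quad d w ((Bm lam w)⁻¹ *ᵥ w k) ((Bm kap w)⁻¹ *ᵥ w l)
  have h2 : w k ⬝ᵥ (((Bm lam w)⁻¹ * Bm d w * (Bm kap w)⁻¹) *ᵥ w l) =
      ((Bm lam w)⁻¹ *ᵥ w k) ⬝ᵥ (Bm d w *ᵥ ((Bm kap w)⁻¹ *ᵥ w l)) := by
    rw [← Matrix.mulVec_mulVec, ← Matrix.mulVec_mulVec, Bm_inv_symm hl hw, dotProduct_comm]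
  rw [h2, h]
  refine Finset.sum_congr rfl fun m _ => ?_
  rw [av_symm hl hw]; rfl

lemma av_sum_sq (hl : ∀ k, 0 < lam k) (hw : Sp w) (k : Fin n) :
    ∑ m, lam m * av lam w k m ^ 2 = av lam w k k := by
  have h := av_sum_mul hl hl hw k k lam
  rw [Matrix.nonsing_inv_mul _ (Bm_isUnit hl hw), Matrix.one_mul] at h
  rw [av, ← h]
  refine Finset.sum_congr rfl fun m _ => ?_
  rw [av_symm hl hw m k, sq]

lemma av_nonneg (hl : ∀ k, 0 < lam k) (hw : Sp w) (k : Fin n) : 0 ≤ av lam w k k := by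
  rw [← av_sum_sq hl hw]
  exact Finset.sum_nonneg fun m _ => mul_nonneg (hl m).le (sq_nonneg _)

lemma av_le (hl : ∀ k, 0 < lam k) (hw : Sp w) (k : Fin n) : lam k * av lam w k k ≤ 1 := by
  have h : lam k * av lam w k k ^ 2 ≤ av lam w k k := by
    conv_rhs => rw [← av_sum_sq hl hw]
    exact Finset.single_le_sum (f := fun m => lam m * av lam w k m ^ 2)
      (fun m _ => mul_nonneg (hl m).le (sq_nonneg _)) (Finset.mem_univ k)
  rcases (av_nonneg hl hw k).eq_or_lt with h0 | h0
  · rw [← h0]; simp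
  · by_contra hc
    push Not at hc
    nlinarith

lemma av_trace (lam' : Fin n → ℝ) :
    ∑ k, lam' k * av lam w k k = ((Bm lam w)⁻¹ * Bm lam' w).trace := by
  rw [Bm, Bm, Matrix.mul_sum, Matrix.trace_sum]
  refine Finset.sum_congr rfl fun k _ => ?_
  rw [Matrix.mul_smul, Matrix.trace_smul, Matrix.mul_vecMulVec, Matrix.trace_vecMulVec,
    dotProduct_comm]
  rfl

lemma av_sum (hl : ∀ k, 0 < lam k) (hw : Sp w) : ∑ k, lam k * av lam w k k = i := by
  rw [av_trace, Matrix.nonsing_inv_mul _ (Bm_isUnit hl hw)]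
  simp

lemma Bm_sub : Bm (fun k => lam k - kap k) w = Bm lam w - Bm kap w := by
  simp [Bm, sub_smul, Finset.sum_sub_distrib]

lemma av_diff (hl : ∀ k, 0 < lam k) (hk : ∀ k, 0 < kap k) (hw : Sp w) (k : Fin n) :
    av kap w k k - av lam w k k =
      ∑ m, (lam m - kap m) * (av lam w k m * av kap w m k) := by
  rw [av_sum_mul hl hk hw k k (fun m => lam m - kap m), Bm_sub, Matrix.mul_sub, Matrix.sub_mul,
    Matrix.nonsing_inv_mul _ (Bm_isUnit hl hw), Matrix.one_mul, Matrix.mul_assoc,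
    Matrix.mul_nonsing_inv _ (Bm_isUnit hk hw), Matrix.mul_one, Matrix.sub_mulVec,
    dotProduct_sub]
  rfl

lemma av_row_le {C : ℝ} (hC : 0 < C) (hl : ∀ k, C⁻¹ ≤ lam k) (hw : Sp w) (k : Fin n) :
    ∑ m, av lam w k m ^ 2 ≤ C ^ 2 := by
  have hl' : ∀ k, 0 < lam k := fun k => (inv_pos.2 hC).trans_le (hl k)
  have h1 := av_sum_sq hl' hw k
  have h2 := av_le hl' hw k
  have h3 := av_nonneg hl' hw k
  have h4 : C⁻¹ * ∑ m, av lam w k m ^ 2 ≤ av lam w k k := by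
    rw [← h1, Finset.mul_sum]
    exact Finset.sum_le_sum fun m _ => mul_le_mul_of_nonneg_right (hl m) (sq_nonneg _)
  have h5 : C⁻¹ * av lam w k k ≤ 1 := (mul_le_mul_of_nonneg_right (hl k) h3).trans h2
  rw [inv_mul_le_iff₀ hC] at h4 h5
  nlinarith

/-- The key second order bound. -/
lemma T_diff_bound {C : ℝ} (hC : 0 < C) (hl : ∀ k, C⁻¹ ≤ lam k) (hk : ∀ k, C⁻¹ ≤ kap k)
    (hw : Sp w) :
    |∑ k, (lam k - kap k) * av kap w k k - ∑ k, (lam k - kap k) * av lam w k k| ≤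
      C ^ 2 * ∑ k, (lam k - kap k) ^ 2 := by
  have hl' : ∀ k, 0 < lam k := fun k => (inv_pos.2 hC).trans_le (hl k)
  have hk' : ∀ k, 0 < kap k := fun k => (inv_pos.2 hC).trans_le (hk k)
  set d : Fin n → ℝ := fun k => lam k - kap k with hd
  have e1 : ∑ k, (lam k - kap k) * av kap w k k - ∑ k, (lam k - kap k) * av lam w k k =
      ∑ k, ∑ m, d k * d m * (av lam w k m * av kap w k m) := by
    rw [← Finset.sum_sub_distrib]
    refine Finset.sum_congr rfl fun k _ => ?_
    rw [← mul_sub, av_diff hl' hk' hw, Finset.mul_sum]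
    refine Finset.sum_congr rfl fun m _ => ?_
    rw [av_symm hk' hw m k, hd]; ring
  rw [e1]
  have e2 : ∀ k m, |d k * d m * (av lam w k m * av kap w k m)| ≤
      (d k ^ 2 * (av lam w k m ^ 2 + av kap w k m ^ 2)
        + d m ^ 2 * (av lam w m k ^ 2 + av kap w m k ^ 2)) / 4 := by
    intro k m
    rw [av_symm hl' hw m k, av_symm hk' hw m k, abs_mul]
    have a1 : |d k * d m| ≤ (d k ^ 2 + d m ^ 2) / 2 := by
      rw [abs_le]; constructor <;> nlinarith [sq_nonneg (d k - d m), sq_nonneg (d k + d m)]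
    have a2 : |av lam w k m * av kap w k m| ≤ (av lam w k m ^ 2 + av kap w k m ^ 2) / 2 := by
      rw [abs_le]; constructor <;> nlinarith [sq_nonneg (av lam w k m - av kap w k m),
        sq_nonneg (av lam w k m + av kap w k m)]
    calc _ ≤ _ := mul_le_mul a1 a2 (abs_nonneg _) (by positivity)
      _ = _ := by ring
  have e3 : ∀ k, ∑ m, d k ^ 2 * (av lam w k m ^ 2 + av kap w k m ^ 2) ≤ d k ^ 2 * (2 * C ^ 2) := by
    intro k
    rw [← Finset.mul_sum, Finset.sum_add_distrib]
    have := av_row_le hC hl hw k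
    have := av_row_le hC hk hw k
    gcongr
    linarith
  calc _ ≤ ∑ k, ∑ m, |d k * d m * (av lam w k m * av kap w k m)| :=
        (Finset.abs_sum_le_sum_abs _ _).trans
          (Finset.sum_le_sum fun k _ => Finset.abs_sum_le_sum_abs _ _)
    _ ≤ ∑ k, ∑ m, (d k ^ 2 * (av lam w k m ^ 2 + av kap w k m ^ 2)
        + d m ^ 2 * (av lam w m k ^ 2 + av kap w m k ^ 2)) / 4 :=
        Finset.sum_le_sum fun k _ => Finset.sum_le_sum fun m _ => e2 k m
    _ = (∑ k, ∑ m, d k ^ 2 * (av lam w k m ^ 2 + av kap w k m ^ 2)) / 2 := by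
        simp_rw [← Finset.sum_div, Finset.sum_add_distrib]
        rw [Finset.sum_comm (f := fun k m => d m ^ 2 * (av lam w m k ^ 2 + av kap w m k ^ 2))]
        ring
    _ ≤ (∑ k, d k ^ 2 * (2 * C ^ 2)) / 2 := by
        have := Finset.sum_le_sum fun k (_ : k ∈ Finset.univ) => e3 k
        linarith
    _ = _ := by rw [← Finset.sum_mul]; ring

end

lemma posDef_log_det_le {i : ℕ} {N : Matrix (Fin i) (Fin i) ℝ} (hN : N.PosDef) :
    Real.log N.det ≤ N.trace - i := by
  have h1 := hN.isHermitian.det_eq_prod_eigenvalues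
  have h2 := hN.isHermitian.trace_eq_sum_eigenvalues
  simp only [RCLike.ofReal_real_eq_id, id] at h1 h2
  rw [h1, h2, Real.log_prod (fun j _ => (hN.eigenvalues_pos j).ne')]
  calc _ ≤ ∑ j, (hN.isHermitian.eigenvalues j - 1) := Finset.sum_le_sum fun j _ =>
        Real.log_le_sub_one_of_pos (hN.eigenvalues_pos j)
    _ = _ := by simp

open scoped MatrixOrder ComplexOrder Matrix.Norms.L2Operator in
lemma posDef_log_det_sub_le {i : ℕ} {X Y : Matrix (Fin i) (Fin i) ℝ} (hX : X.PosDef)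
    (hY : Y.PosDef) : Real.log X.det - Real.log Y.det ≤ (Y⁻¹ * X).trace - i := by
  obtain ⟨S, hS⟩ : ∃ S : Matrix (Fin i) (Fin i) ℝ, Y⁻¹ = Sᴴ * S := by
    have := hY.inv.posSemidef
    exact CStarAlgebra.nonneg_iff_eq_star_mul_self.mp this.nonneg
  have hYi := hY.inv
  have hSd : S.det ≠ 0 := by
    intro h0
    have := hYi.det_pos
    rw [hS, det_mul, h0] at this
    simp at this
  have hN : (S * X * Sᴴ).PosDef := by
    refine hX.mul_mul_conjTranspose_same (B := S) ?_
    exact Matrix.vecMul_injective_iff_isUnit.2 ((Matrix.isUnit_iff_isUnit_det _).2 hSd.isUnit)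
  have h := posDef_log_det_le hN
  have ht : (S * X * Sᴴ).trace = (Y⁻¹ * X).trace := by
    rw [Matrix.trace_mul_comm, ← Matrix.mul_assoc, hS]
  have hd : (S * X * Sᴴ).det = X.det * (Y.det)⁻¹ := by
    have : (Y⁻¹).det = (Y.det)⁻¹ := by simp [Matrix.det_nonsing_inv]
    rw [← this, hS, det_mul, det_mul, det_mul]; ring
  rw [ht, hd, Real.log_mul hX.det_pos.ne' (inv_ne_zero hY.det_pos.ne'), Real.log_inv] at h
  linarith

lemma logdet_sandwich {n i : ℕ} {lam kap : Fin n → ℝ} {w : Fin n → Fin i → ℝ}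
    (hl : ∀ k, 0 < lam k) (hk : ∀ k, 0 < kap k) (hw : Sp w) :
    Real.log (Bm lam w).det - Real.log (Bm kap w).det ≤ ∑ k, (lam k - kap k) * av kap w k k := by
  have h := posDef_log_det_sub_le (Bm_posDef hl hw) (Bm_posDef hk hw)
  rw [← av_trace] at h
  have h2 := av_sum hk hw
  simp_rw [sub_mul, Finset.sum_sub_distrib]
  linarith

lemma logdet_diff {n i : ℕ} {lam kap : Fin n → ℝ} {w : Fin n → Fin i → ℝ} {C : ℝ}
    (hC : 0 < C) (hl : ∀ k, C⁻¹ ≤ lam k) (hk : ∀ k, C⁻¹ ≤ kap k) (hw : Sp w) :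
    |Real.log (Bm lam w).det - Real.log (Bm kap w).det - ∑ k, (lam k - kap k) * av kap w k k| ≤
      C ^ 2 * ∑ k, (lam k - kap k) ^ 2 := by
  have hl' : ∀ k, 0 < lam k := fun k => (inv_pos.2 hC).trans_le (hl k)
  have hk' : ∀ k, 0 < kap k := fun k => (inv_pos.2 hC).trans_le (hk k)
  have h1 := logdet_sandwich hl' hk' hw
  have h2 := logdet_sandwich hk' hl' hw
  have h3 := T_diff_bound hC hl hk hw
  have h4 : ∑ k, (kap k - lam k) * av lam w k k = - ∑ k, (lam k - kap k) * av lam w k k := by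
    rw [← Finset.sum_neg_distrib]
    exact Finset.sum_congr rfl fun k _ => by ring
  rw [h4] at h2
  rw [abs_le] at h3 ⊢
  constructor <;> linarith

/-- Sherman-Morrison. -/
lemma sherman {n i : ℕ} {lam : Fin n → ℝ} {w : Fin n → Fin i → ℝ} (hl : ∀ k, 0 < lam k)
    (k : Fin n) (hw : ∀ x : Fin i → ℝ, (∀ l ∈ Finset.univ.erase k, w l ⬝ᵥ x = 0) → x = 0) :
    (1 + lam k * (w k ⬝ᵥ ((∑ l ∈ Finset.univ.erase k,
            lam l • Matrix.vecMulVec (w l) (w l))⁻¹).mulVec (w k)))⁻¹ =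
      1 - lam k * av lam w k k := by
  have hw' : Sp w := fun x hx => hw x fun l _ => hx l
  have hP := sumVec_posDef _ lam hl w hw
  set D := ∑ l ∈ Finset.univ.erase k, lam l • Matrix.vecMulVec (w l) (w l) with hD
  have hB : Bm lam w = D + lam k • Matrix.vecMulVec (w k) (w k) := by
    rw [Bm, hD, Finset.sum_erase_add _ _ (Finset.mem_univ k)]
  set v := D⁻¹ *ᵥ w k with hv
  have hDv : D *ᵥ v = w k := by
    rw [hv, Matrix.mulVec_mulVec, Matrix.mul_nonsing_inv _ hP.det_pos.ne'.isUnit,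
      Matrix.one_mulVec]
  set r := w k ⬝ᵥ v with hr
  have hr0 : 0 ≤ r := by
    have := hP.inv.posSemidef.dotProduct_mulVec_nonneg (w k)
    simpa using this
  have hpos : 0 < 1 + lam k * r := by have := hl k; positivity
  have hBv : Bm lam w *ᵥ v = (1 + lam k * r) • w k := by
    rw [hB, Matrix.add_mulVec, hDv, Matrix.smul_mulVec, Matrix.vecMulVec_mulVec, add_smul,
      one_smul, mul_smul]
    congr 1
    rw [← hr]
    simp
  have hv2 : v = (1 + lam k * r) • ((Bm lam w)⁻¹ *ᵥ w k) := by
    rw [← Matrix.mulVec_smul, ← hBv, Matrix.mulVec_mulVec,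
      Matrix.nonsing_inv_mul _ (Bm_isUnit hl hw'), Matrix.one_mulVec]
  have hr2 : r = (1 + lam k * r) * av lam w k k := by
    conv_lhs => rw [hr, hv2, dotProduct_smul]
    rfl
  refine inv_eq_of_mul_eq_one_right ?_
  linear_combination lam k * hr2

instance instProbGaussianPi (n : ℕ) : IsProbabilityMeasure (gaussianPi n) := by
  unfold gaussianPi; infer_instance

lemma measurable_euclidNorm {n : ℕ} : Measurable (euclidNorm (n := n)) := by
  unfold euclidNorm
  fun_prop

lemma measurable_normalize {n : ℕ} :
    Measurable (fun x : Fin n → ℝ => (euclidNorm x)⁻¹ • x) :=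
  (measurable_euclidNorm.inv).smul measurable_id

instance instProbUniformSphere (n : ℕ) : IsProbabilityMeasure (uniformSphere n) :=
  Measure.isProbabilityMeasure_map measurable_normalize.aemeasurable

noncomputable def gdens (n : ℕ) (x : EuclideanSpace ℝ (Fin n)) : ℝ :=
  ((2 * Real.pi) ^ ((n : ℝ) / 2))⁻¹ * Real.exp (-‖x‖ ^ 2 / 2)

lemma gdens_nonneg (n : ℕ) (x : EuclideanSpace ℝ (Fin n)) : 0 ≤ gdens n x := by
  unfold gdens; positivity

lemma gdens_cont (n : ℕ) : Continuous (gdens n) := by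
  unfold gdens; fun_prop

lemma gdens_integral_cexp (n : ℕ) (t : EuclideanSpace ℝ (Fin n)) :
    ∫ x, gdens n x • Complex.exp (inner ℝ x t * Complex.I) = Complex.exp (-‖t‖ ^ 2 / 2) := by
  have h := GaussianFourier.integral_cexp_neg_mul_sq_norm_add (V := EuclideanSpace ℝ (Fin n))
    (b := 1/2) (by norm_num) Complex.I t
  have h2 : ∀ x : EuclideanSpace ℝ (Fin n),
      gdens n x • Complex.exp (inner ℝ x t * Complex.I) =
      (((2 * Real.pi) ^ ((n : ℝ) / 2))⁻¹ : ℝ) *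
        Complex.exp (-(1/2) * ‖x‖ ^ 2 + Complex.I * inner ℝ t x) := by
    intro x
    rw [Complex.exp_add, gdens, Complex.real_smul, real_inner_comm]
    push_cast
    rw [mul_assoc, mul_comm Complex.I]
    congr 3
    ring_nf
  simp_rw [h2]
  rw [integral_const_mul, h]
  simp only [finrank_euclideanSpace, Fintype.card_fin]
  have h3 : ((Real.pi : ℂ) / (1/2)) ^ ((n : ℂ) / 2) = (((2 * Real.pi) ^ ((n : ℝ) / 2) : ℝ) : ℂ) := by
    rw [Complex.ofReal_cpow (by positivity)]
    push_cast
    congr 1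
    ring
  rw [h3, ← mul_assoc, ← Complex.ofReal_mul, inv_mul_cancel₀ (by positivity)]
  simp only [Complex.ofReal_one, one_mul, Complex.I_sq]
  congr 1
  ring

lemma gdens_integrable (n : ℕ) : Integrable (gdens n) := by
  have h := GaussianFourier.integrable_cexp_neg_mul_sq_norm_add (V := EuclideanSpace ℝ (Fin n))
    (b := 1/2) (by norm_num) 0 0
  have h2 := h.norm
  unfold gdens
  refine Integrable.const_mul ?_ _
  refine h2.congr (Eventually.of_forall fun x => ?_)
  simp only [Complex.norm_exp]
  congr 1
  simp
  rw [show (‖x‖ : ℂ)^2 = ((‖x‖^2 : ℝ) : ℂ) by push_cast; rfl, Complex.ofReal_re]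
  ring

lemma stdGaussian_eq_withDensity (n : ℕ) :
    stdGaussian (EuclideanSpace ℝ (Fin n)) =
      (volume : Measure (EuclideanSpace ℝ (Fin n))).withDensity
        (fun x => ENNReal.ofReal (gdens n x)) := by
  have : IsFiniteMeasure ((volume : Measure (EuclideanSpace ℝ (Fin n))).withDensity
        (fun x => ENNReal.ofReal (gdens n x))) :=
    isFiniteMeasure_withDensity_ofReal (gdens_integrable n).2
  apply Measure.ext_of_charFun
  ext t
  rw [charFun_stdGaussian, charFun_apply, integral_withDensity_eq_integral_toReal_smul
    (by have := (gdens_cont n).measurable; fun_prop) (by simp)]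
  simp_rw [ENNReal.toReal_ofReal (gdens_nonneg n _)]
  rw [gdens_integral_cexp]

lemma gaussianPi_map_toLp (n : ℕ) :
    (gaussianPi n).map (WithLp.toLp 2) = stdGaussian (EuclideanSpace ℝ (Fin n)) :=
  map_pi_eq_stdGaussian

lemma integral_gaussianPi {n : ℕ} {F : Type*} [NormedAddCommGroup F] [NormedSpace ℝ F]
    (f : (Fin n → ℝ) → F) :
    ∫ x, f x ∂(gaussianPi n) = ∫ x : EuclideanSpace ℝ (Fin n), gdens n x • f (WithLp.ofLp x) := by
  have h : ∫ x, f (WithLp.ofLp x) ∂(stdGaussian (EuclideanSpace ℝ (Fin n))) =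
      ∫ x, f x ∂(gaussianPi n) := by
    rw [← gaussianPi_map_toLp]
    exact (MeasurableEquiv.toLp 2 (Fin n → ℝ)).measurableEmbedding.integral_map
      (μ := gaussianPi n) (fun x : EuclideanSpace ℝ (Fin n) => f (WithLp.ofLp x))
  rw [← h, stdGaussian_eq_withDensity, integral_withDensity_eq_integral_toReal_smul
    (by have := (gdens_cont n).measurable; fun_prop) (by simp)]
  simp_rw [ENNReal.toReal_ofReal (gdens_nonneg n _)]

lemma gaussianPi_ac (n : ℕ) : gaussianPi n ≪ volume := by
  have h : (gaussianPi n) = (stdGaussian (EuclideanSpace ℝ (Fin n))).map WithLp.ofLp := by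
    rw [← gaussianPi_map_toLp, Measure.map_map (by fun_prop) (by fun_prop)]
    exact Measure.map_id.symm
  rw [h, stdGaussian_eq_withDensity, ← (PiLp.volume_preserving_ofLp (Fin n)).map_eq]
  exact (withDensity_absolutelyContinuous _ _).map (by fun_prop)

lemma gaussianPi_hyperplane {n : ℕ} (x : Fin n → ℝ) (hx : x ≠ 0) :
    ∀ᵐ u ∂(gaussianPi n), u ⬝ᵥ x ≠ 0 := by
  refine (gaussianPi_ac n).ae_le ?_
  have : {u : Fin n → ℝ | u ⬝ᵥ x = 0} = (LinearMap.ker (dotProductBilin ℝ ℝ x) : Set (Fin n → ℝ)) := by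
    ext u; simp [dotProduct_comm]
  change ∀ᵐ u ∂(volume : Measure (Fin n → ℝ)), u ⬝ᵥ x ≠ 0
  rw [ae_iff]
  simp only [ne_eq, not_not]
  rw [this]
  apply Measure.addHaar_submodule
  intro h
  rw [LinearMap.ker_eq_top] at h
  apply hx
  have := congrArg (fun f => f x) h
  simpa using this

lemma uniformSphere_hyperplane {n : ℕ} (x : Fin n → ℝ) (hx : x ≠ 0) :
    ∀ᵐ u ∂(uniformSphere n), u ⬝ᵥ x ≠ 0 := by
  unfold uniformSphere
  rw [ae_map_iff measurable_normalize.aemeasurable]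
  · filter_upwards [gaussianPi_hyperplane x hx] with u hu
    rw [smul_dotProduct, smul_eq_mul]
    refine mul_ne_zero (inv_ne_zero ?_) hu
    intro h
    apply hu
    unfold euclidNorm at h
    rw [Real.sqrt_eq_zero (by positivity), Finset.sum_eq_zero_iff_of_nonneg (by intros; positivity)] at h
    have : u = 0 := by
      ext j; simpa using h j (Finset.mem_univ _)
    simp [this]
  · exact (measurableSet_eq_fun (by unfold dotProduct; fun_prop) measurable_const).compl

lemma mulVec_sq_sum {n : ℕ} {U : Matrix (Fin n) (Fin n) ℝ} (hU : Uᵀ * U = 1) (x : Fin n → ℝ) :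
    ∑ j, (U *ᵥ x) j ^ 2 = ∑ j, x j ^ 2 := by
  have h : (U *ᵥ x) ⬝ᵥ (U *ᵥ x) = x ⬝ᵥ x := by
    rw [dotProduct_mulVec, vecMul_mulVec, hU, vecMul_one]
  simpa [dotProduct, sq] using h

lemma euclidNorm_mulVec {n : ℕ} {U : Matrix (Fin n) (Fin n) ℝ} (hU : Uᵀ * U = 1) (x : Fin n → ℝ) :
    euclidNorm (U *ᵥ x) = euclidNorm x := by
  unfold euclidNorm; rw [mulVec_sq_sum hU]

lemma gaussianPi_rot {n : ℕ} {U : Matrix (Fin n) (Fin n) ℝ} (hU : Uᵀ * U = 1) :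
    MeasurePreserving (fun x => U *ᵥ x) (gaussianPi n) (gaussianPi n) := by
  refine ⟨by fun_prop, ?_⟩
  let L : EuclideanSpace ℝ (Fin n) →ₗᵢ[ℝ] EuclideanSpace ℝ (Fin n) :=
    { toLinearMap := Matrix.toEuclideanLin U
      norm_map' := fun x => by
        rw [EuclideanSpace.norm_eq, EuclideanSpace.norm_eq]
        congr 1
        have := mulVec_sq_sum hU (WithLp.ofLp x)
        simpa using this }
  let f := L.toLinearIsometryEquiv rfl
  have h := stdGaussian_map f
  have e : (gaussianPi n) = (stdGaussian (EuclideanSpace ℝ (Fin n))).map WithLp.ofLp := by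
    rw [← gaussianPi_map_toLp, Measure.map_map (by fun_prop) (by fun_prop)]
    exact Measure.map_id.symm
  conv_rhs => rw [e, ← h, ← gaussianPi_map_toLp]
  rw [Measure.map_map (by fun_prop) (by fun_prop), Measure.map_map (by fun_prop) (by fun_prop)]
  rfl

lemma uniformSphere_rot {n : ℕ} {U : Matrix (Fin n) (Fin n) ℝ} (hU : Uᵀ * U = 1) :
    MeasurePreserving (fun x => U *ᵥ x) (uniformSphere n) (uniformSphere n) := by
  refine ⟨by fun_prop, ?_⟩
  unfold uniformSphere
  rw [Measure.map_map (by fun_prop) measurable_normalize]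
  conv_rhs => rw [← (gaussianPi_rot hU).map_eq, Measure.map_map measurable_normalize (by fun_prop)]
  congr 1
  ext x
  simp [euclidNorm_mulVec hU, mulVec_smul]

/-- product of rotations -/
lemma pi_rot {n p : ℕ} {ν : Measure (Fin n → ℝ)} [IsProbabilityMeasure ν]
    {g : (Fin n → ℝ) → (Fin n → ℝ)} (hg : MeasurePreserving g ν ν) :
    MeasurePreserving (fun ω : Fin p → Fin n → ℝ => fun i => g (ω i))
      (Measure.pi fun _ => ν) (Measure.pi fun _ => ν) :=
  measurePreserving_pi _ _ (fun _ => hg)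

lemma pi_map_comp_inj {X : Type*} [MeasurableSpace X] (ν : Measure X) [IsProbabilityMeasure ν]
    {m n : ℕ} (e : Fin m → Fin n) (he : Function.Injective e) :
    MeasurePreserving (fun w : Fin n → X => fun j => w (e j))
      (Measure.pi fun _ => ν) (Measure.pi fun _ => ν) := by
  refine ⟨by fun_prop, ?_⟩
  have h1 : iIndepFun (fun (i : Fin n) (w : Fin n → X) => w i) (Measure.pi fun _ : Fin n => ν) :=
    iIndepFun_pi (X := fun _ => id) (fun _ => aemeasurable_id)
  have h2 := h1.precomp he
  have h3 := h2.map_fun_eq_pi_map (fun i => (measurable_pi_apply (e i)).aemeasurable)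
  rw [h3]
  congr 1
  ext1 i
  exact (measurePreserving_eval (fun _ : Fin n => ν) (e i)).map_eq

lemma exists_orth {n i : ℕ} (hi : i < n) (w : Fin i → Fin n → ℝ) :
    ∃ x : Fin n → ℝ, x ≠ 0 ∧ ∀ j, w j ⬝ᵥ x = 0 := by
  let f : (Fin n → ℝ) →ₗ[ℝ] (Fin i → ℝ) := Matrix.mulVecLin (Matrix.of w)
  have : ∃ x ∈ LinearMap.ker f, x ≠ 0 := by
    apply (Submodule.ne_bot_iff _).1
    apply LinearMap.ker_ne_bot_of_finrank_lt
    simpa using hi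
  obtain ⟨x, hx, hx0⟩ := this
  refine ⟨x, hx0, fun j => ?_⟩
  have := congrFun (LinearMap.mem_ker.1 hx) j
  simpa [f, mulVec] using this

lemma ae_linearIndependent {n : ℕ} (ν : Measure (Fin n → ℝ)) [IsProbabilityMeasure ν]
    (hν : ∀ x : Fin n → ℝ, x ≠ 0 → ∀ᵐ u ∂ν, u ⬝ᵥ x ≠ 0) (i : ℕ) (hi : i ≤ n) :
    ∀ᵐ w ∂(Measure.pi fun _ : Fin i => ν), LinearIndependent ℝ w := by
  induction i with
  | zero => exact Eventually.of_forall fun w => linearIndependent_empty_type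
  | succ i ih =>
    have ih' := ih (by omega)
    have hmp := (measurePreserving_piFinSuccAbove (fun _ : Fin (i+1) => ν) 0)
    have key : ∀ᵐ z ∂(ν.prod (Measure.pi fun _ : Fin i => ν)),
        LinearIndependent ℝ (Fin.cons z.1 z.2 : Fin (i+1) → Fin n → ℝ) := by
      have hms : MeasurableSet {z : (Fin n → ℝ) × (Fin i → Fin n → ℝ) |
          LinearIndependent ℝ (Fin.cons z.1 z.2 : Fin (i+1) → Fin n → ℝ)} := by
        have ho : IsOpen {f : Fin (i+1) → Fin n → ℝ | LinearIndependent ℝ f} :=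
          isOpen_setOfPred_linearIndependent
        refine ho.measurableSet.preimage ?_
        refine measurable_pi_iff.2 fun a => ?_
        refine Fin.cases ?_ (fun j => ?_) a
        · simpa using measurable_fst
        · simp only [Fin.cons_succ]; fun_prop
      rw [Measure.ae_prod_iff_ae_ae hms, Measure.ae_ae_comm hms]
      filter_upwards [ih'] with w hw
      obtain ⟨x, hx0, hx⟩ := exists_orth (show i < n by omega) w
      filter_upwards [hν x hx0] with u hu
      rw [linearIndependent_finCons]
      refine ⟨hw, fun hmem => hu ?_⟩
      have : Submodule.span ℝ (Set.range w) ≤ LinearMap.ker (dotProductBilin ℝ ℝ x) := by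
        rw [Submodule.span_le]
        rintro _ ⟨j, rfl⟩
        simpa [dotProduct_comm] using hx j
      simpa [dotProduct_comm] using this hmem
    have := hmp.quasiMeasurePreserving.ae key
    filter_upwards [this] with w hw
    convert hw using 1
    ext a
    refine Fin.cases ?_ (fun j => ?_) a <;> simp [MeasurableEquiv.piFinSuccAbove, Fin.insertNthEquiv] <;> rfl

lemma ae_Sp_sphere {n p : ℕ} (hp : p ≤ n) :
    ∀ᵐ ω ∂(Measure.pi fun _ : Fin p => uniformSphere n), Sp (fun k j => ω j k) := by
  filter_upwards [ae_linearIndependent (uniformSphere n) uniformSphere_hyperplane p hp] with ω hω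
  intro x hx
  rw [Fintype.linearIndependent_iff] at hω
  ext j
  refine hω x ?_ j
  ext k
  have := hx k
  simpa [dotProduct, mul_comm] using this

lemma ae_erase_gauss {n i : ℕ} (hi : i < n) (k : Fin n) :
    ∀ᵐ w ∂(Measure.pi fun _ : Fin n => gaussianPi i),
      ∀ x : Fin i → ℝ, (∀ l ∈ Finset.univ.erase k, w l ⬝ᵥ x = 0) → x = 0 := by
  obtain ⟨m, rfl⟩ : ∃ m, n = m + 1 := ⟨n - 1, by omega⟩
  let e : Fin i → Fin (m+1) := fun j => k.succAbove (Fin.castLE (by omega) j)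
  have he : Function.Injective e := fun a b h => by
    have := Fin.succAbove_right_injective h
    exact Fin.castLE_injective _ this
  have h1 := (pi_map_comp_inj (gaussianPi i) e he).quasiMeasurePreserving.ae
    (ae_linearIndependent (gaussianPi i) gaussianPi_hyperplane i le_rfl)
  filter_upwards [h1] with w hw x hx
  have hu : IsUnit (Matrix.of (fun j => w (e j))) := by
    rw [← Matrix.linearIndependent_rows_iff_isUnit]; exact hw
  have hinj := Matrix.mulVec_injective_of_isUnit hu
  apply hinj
  rw [mulVec_zero]
  ext j
  exact hx (e j) (by simp [e, Fin.succAbove_ne])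

lemma Sp_of_erase {n i : ℕ} {w : Fin n → Fin i → ℝ} (k : Fin n)
    (h : ∀ x : Fin i → ℝ, (∀ l ∈ Finset.univ.erase k, w l ⬝ᵥ x = 0) → x = 0) : Sp w :=
  fun x hx => h x fun l _ => hx l

lemma ae_Sp_gauss {n i : ℕ} (hi : i < n) :
    ∀ᵐ w ∂(Measure.pi fun _ : Fin n => gaussianPi i), Sp w := by
  filter_upwards [ae_erase_gauss hi ⟨0, by omega⟩] with w hw
  exact Sp_of_erase _ hw

lemma measurable_Bm {n i : ℕ} (lam : Fin n → ℝ) (a b : Fin i) :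
    Measurable (fun w : Fin n → Fin i → ℝ => Bm lam w a b) := by
  simp only [Bm, Matrix.sum_apply, Matrix.smul_apply, vecMulVec_apply]
  fun_prop

lemma measurable_det_of {α : Type*} [MeasurableSpace α] {i : ℕ} {M : α → Matrix (Fin i) (Fin i) ℝ}
    (h : ∀ a b, Measurable fun w => M w a b) : Measurable fun w => (M w).det := by
  simp only [Matrix.det_apply]
  refine Finset.measurable_sum _ fun σ _ => ?_
  refine Measurable.const_smul ?_ _
  exact Finset.measurable_prod _ fun j _ => h _ _

lemma measurable_inv_of {α : Type*} [MeasurableSpace α] {i : ℕ} {M : α → Matrix (Fin i) (Fin i) ℝ}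
    (h : ∀ a b, Measurable fun w => M w a b) (a b : Fin i) : Measurable fun w => (M w)⁻¹ a b := by
  simp only [Matrix.inv_def, Matrix.smul_apply, Ring.inverse_eq_inv', smul_eq_mul]
  refine (measurable_det_of h).inv.mul ?_
  simp only [Matrix.adjugate_apply]
  refine measurable_det_of fun c d => ?_
  simp only [Matrix.updateRow_apply]
  split_ifs
  · exact measurable_const
  · exact h _ _

lemma measurable_av {n i : ℕ} (lam : Fin n → ℝ) (k l : Fin n) :
    Measurable (fun w : Fin n → Fin i → ℝ => av lam w k l) := by
  simp only [av, dotProduct, mulVec]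
  have := measurable_inv_of (measurable_Bm (i := i) lam)
  refine Finset.measurable_sum _ fun a _ => ?_
  refine Measurable.mul (by fun_prop) ?_
  refine Finset.measurable_sum _ fun b _ => ?_
  exact (this a b).mul (by fun_prop)

/-- expectation of the quadratic form -/
noncomputable def mav {n : ℕ} (i : ℕ) (lam : Fin n → ℝ) (k : Fin n) : ℝ :=
  ∫ w : Fin n → Fin i → ℝ, av lam w k k ∂(Measure.pi fun _ : Fin n => gaussianPi i)

lemma av_integrable {n i : ℕ} (hi : i < n) {lam : Fin n → ℝ} (hl : ∀ k, 0 < lam k) (k : Fin n) :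
    Integrable (fun w : Fin n → Fin i → ℝ => av lam w k k)
      (Measure.pi fun _ : Fin n => gaussianPi i) := by
  refine Integrable.of_bound (C := (lam k)⁻¹) (measurable_av lam k k).aestronglyMeasurable ?_
  filter_upwards [ae_Sp_gauss hi] with w hw
  rw [Real.norm_of_nonneg (av_nonneg hl hw k)]
  rw [← one_div, le_div_iff₀ (hl k), mul_comm]
  exact av_le hl hw k

lemma mav_nonneg {n i : ℕ} (hi : i < n) {lam : Fin n → ℝ} (hl : ∀ k, 0 < lam k) (k : Fin n) :
    0 ≤ mav i lam k := by
  refine integral_nonneg_of_ae ?_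
  filter_upwards [ae_Sp_gauss hi] with w hw
  exact av_nonneg hl hw k

lemma mav_le {n i : ℕ} (hi : i < n) {lam : Fin n → ℝ} (hl : ∀ k, 0 < lam k) (k : Fin n) :
    lam k * mav i lam k ≤ 1 := by
  unfold mav
  rw [← integral_const_mul]
  have : ∫ w : Fin n → Fin i → ℝ, (1:ℝ) ∂(Measure.pi fun _ : Fin n => gaussianPi i) = 1 := by simp
  rw [← this]
  refine integral_mono_ae ((av_integrable hi hl k).const_mul _) (integrable_const _) ?_
  filter_upwards [ae_Sp_gauss hi] with w hw
  exact av_le hl hw k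

lemma mav_sum {n i : ℕ} (hi : i < n) {lam : Fin n → ℝ} (hl : ∀ k, 0 < lam k) :
    ∑ k, lam k * mav i lam k = i := by
  unfold mav
  simp_rw [← integral_const_mul]
  rw [← integral_finsetSum _ fun k _ => (av_integrable hi hl k).const_mul _]
  have : ∫ w : Fin n → Fin i → ℝ, (i:ℝ) ∂(Measure.pi fun _ : Fin n => gaussianPi i) = i := by simp
  rw [← this]
  refine integral_congr_ae ?_
  filter_upwards [ae_Sp_gauss hi] with w hw
  exact av_sum hl hw

lemma tval_eq {n i : ℕ} (hi : i < n) {lam : Fin n → ℝ} (hl : ∀ k, 0 < lam k) (k : Fin n) :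
    tval i lam k = 1 - lam k * mav i lam k := by
  have h : tval i lam k = ∫ w : Fin n → Fin i → ℝ, (1 - lam k * av lam w k k)
      ∂(Measure.pi fun _ : Fin n => gaussianPi i) := by
    refine integral_congr_ae ?_
    filter_upwards [ae_erase_gauss hi k] with w hw
    exact sherman hl k hw
  rw [h, integral_sub (integrable_const _) ((av_integrable hi hl k).const_mul _),
    integral_const_mul]
  simp [mav]

lemma Bm_const_perm {n i : ℕ} (c : ℝ) (w : Fin n → Fin i → ℝ) (σ : Equiv.Perm (Fin n)) :
    Bm (fun _ => c) (fun l => w (σ l)) = Bm (fun _ => c) w := by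
  unfold Bm
  exact Equiv.sum_comp σ fun l => c • vecMulVec (w l) (w l)

lemma av_const_perm {n i : ℕ} (c : ℝ) (w : Fin n → Fin i → ℝ) (σ : Equiv.Perm (Fin n))
    (k l : Fin n) :
    av (fun _ => c) (fun l => w (σ l)) k l = av (fun _ => c) w (σ k) (σ l) := by
  unfold av
  rw [Bm_const_perm]

lemma mav_const {n : ℕ} (i : ℕ) (c : ℝ) (k l : Fin n) :
    mav i (fun _ => c) k = mav i (fun _ => c) l := by
  have h := pi_map_comp_inj (gaussianPi i) (Equiv.swap k l) (Equiv.injective _)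
  unfold mav
  conv_lhs => rw [← h.map_eq, integral_map h.measurable.aemeasurable
    (measurable_av _ k k).aestronglyMeasurable]
  simp_rw [av_const_perm, Equiv.swap_apply_left]

lemma tval_bounds {n i : ℕ} (hi : i < n) {lam : Fin n → ℝ} {C c : ℝ} (hC : 0 < C)
    (hl : ∀ k, C⁻¹ ≤ lam k) (hc : C⁻¹ ≤ c) (hc2 : c ≤ C) (hsum : ∑ k, (lam k - c) = 0) :
    |∑ k, (lam k - c) * tval i lam k| ≤ (C ^ 3 + C) * ∑ k, (lam k - c) ^ 2 := by
  have hl0 : ∀ k, 0 < lam k := fun k => lt_of_lt_of_le (by positivity) (hl k)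
  have hc0 : 0 < c := lt_of_lt_of_le (by positivity) hc
  have e1 : ∑ k, (lam k - c) * tval i lam k =
      -(c * ∑ k, (lam k - c) * mav i lam k) - ∑ k, (lam k - c)^2 * mav i lam k := by
    have : ∑ k, (lam k - c) * tval i lam k = ∑ k, (lam k - c) +
      (-(c * ∑ k, (lam k - c) * mav i lam k) - ∑ k, (lam k - c)^2 * mav i lam k) := by
      rw [Finset.mul_sum, ← Finset.sum_neg_distrib, ← Finset.sum_sub_distrib,
        ← Finset.sum_add_distrib]
      refine Finset.sum_congr rfl fun k _ => ?_
      rw [tval_eq hi hl0]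
      ring
    rw [this, hsum, zero_add]
  have e0 : ∑ k, (lam k - c) * mav i (fun _ => c) k = 0 := by
    have : ∀ k, (lam k - c) * mav i (fun _ => c) k =
        (lam k - c) * mav i (fun _ => c) (⟨0, by omega⟩ : Fin n) := fun k => by
      rw [mav_const i c k ⟨0, by omega⟩]
    simp_rw [this, ← Finset.sum_mul, hsum, zero_mul]
  have e2 : |∑ k, (lam k - c) * mav i lam k| ≤ C ^ 2 * ∑ k, (lam k - c) ^ 2 := by
    have hinteg : ∀ (kap : Fin n → ℝ), (∀ k, 0 < kap k) →
        Integrable (fun w : Fin n → Fin i → ℝ => ∑ k, (lam k - c) * av kap w k k)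
          (Measure.pi fun _ : Fin n => gaussianPi i) := fun kap hk =>
      integrable_finsetSum _ fun k _ => (av_integrable hi hk k).const_mul _
    have hE : ∀ (kap : Fin n → ℝ), (∀ k, 0 < kap k) → ∑ k, (lam k - c) * mav i kap k =
        ∫ w : Fin n → Fin i → ℝ, ∑ k, (lam k - c) * av kap w k k
          ∂(Measure.pi fun _ : Fin n => gaussianPi i) := fun kap hk => by
      rw [integral_finsetSum _ fun k _ => (av_integrable hi hk k).const_mul _]
      simp_rw [integral_const_mul]; rfl
    have : ∑ k, (lam k - c) * mav i lam k =
      -(∫ w : Fin n → Fin i → ℝ, (∑ k, (lam k - c) * av (fun _ => c) w k k -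
        ∑ k, (lam k - c) * av lam w k k) ∂(Measure.pi fun _ : Fin n => gaussianPi i)) := by
      rw [integral_sub (hinteg _ fun _ => hc0) (hinteg _ hl0), ← hE _ hl0, ← hE _ (fun _ => hc0), e0]
      ring
    rw [this, abs_neg, ← Real.norm_eq_abs]
    refine (norm_integral_le_of_norm_le_const (C := C ^ 2 * ∑ k, (lam k - c) ^ 2) ?_).trans ?_
    · filter_upwards [ae_Sp_gauss hi] with w hw
      exact T_diff_bound hC hl (fun _ => hc) hw
    · simp
  have e3 : |∑ k, (lam k - c)^2 * mav i lam k| ≤ C * ∑ k, (lam k - c) ^ 2 := by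
    rw [abs_of_nonneg (Finset.sum_nonneg fun k _ => mul_nonneg (sq_nonneg _) (mav_nonneg hi hl0 k)),
      Finset.mul_sum]
    refine Finset.sum_le_sum fun k _ => ?_
    rw [mul_comm]
    refine mul_le_mul_of_nonneg_right ?_ (sq_nonneg _)
    have h1 := mav_le hi hl0 k
    have h2 := mul_le_mul_of_nonneg_right (hl k) (mav_nonneg hi hl0 k)
    have h3 : C⁻¹ * mav i lam k ≤ 1 := h2.trans h1
    rwa [inv_mul_le_iff₀ hC, mul_one] at h3
  rw [e1]
  have e4 : |c * ∑ k, (lam k - c) * mav i lam k| ≤ C * (C ^ 2 * ∑ k, (lam k - c) ^ 2) := by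
    rw [abs_mul, abs_of_pos hc0]
    exact mul_le_mul hc2 e2 (abs_nonneg _) hC.le
  rw [abs_le] at *
  constructor <;> nlinarith [e3.1, e3.2, e4.1, e4.2]

lemma tval_nonneg {n i : ℕ} (hi : i < n) {lam : Fin n → ℝ} (hl : ∀ k, 0 < lam k) (k : Fin n) :
    0 ≤ tval i lam k := by
  rw [tval_eq hi hl]; linarith [mav_le hi hl k]

lemma tval_le_one {n i : ℕ} (hi : i < n) {lam : Fin n → ℝ} (hl : ∀ k, 0 < lam k) (k : Fin n) :
    tval i lam k ≤ 1 := by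
  rw [tval_eq hi hl]; linarith [mul_nonneg (hl k).le (mav_nonneg hi hl k)]

lemma tval_sum {n i : ℕ} (hi : i < n) {lam : Fin n → ℝ} (hl : ∀ k, 0 < lam k) :
    ∑ k, tval i lam k = (n : ℝ) - i := by
  simp_rw [tval_eq hi hl]
  rw [Finset.sum_sub_distrib, mav_sum hi hl]
  simp

lemma tval_lin {n i : ℕ} (hi : i < n) {lam : Fin n → ℝ} {C c : ℝ} (hC : 0 < C)
    (hl : ∀ k, C⁻¹ ≤ lam k) (hc : C⁻¹ ≤ c) (hc2 : c ≤ C) (hsum : ∑ k, (lam k - c) = 0) :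
    |∑ k, lam k * tval i lam k - c * ((n:ℝ) - i)| ≤ (C ^ 3 + C) * ∑ k, (lam k - c) ^ 2 := by
  have hl0 : ∀ k, 0 < lam k := fun k => lt_of_lt_of_le (by positivity) (hl k)
  rw [← tval_sum hi hl0, Finset.mul_sum, ← Finset.sum_sub_distrib]
  simp_rw [← sub_mul]
  exact tval_bounds hi hC hl hc hc2 hsum

lemma tval_quad {n i : ℕ} (hi : i < n) {lam : Fin n → ℝ} {C c : ℝ} (hC : 0 < C)
    (hl : ∀ k, C⁻¹ ≤ lam k) (hc : C⁻¹ ≤ c) (hc2 : c ≤ C) (hsum : ∑ k, (lam k - c) = 0) :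
    |∑ k, lam k ^ 2 * tval i lam k - c ^ 2 * ((n:ℝ) - i)| ≤
      (2 * C * (C ^ 3 + C) + 1) * ∑ k, (lam k - c) ^ 2 := by
  have hl0 : ∀ k, 0 < lam k := fun k => lt_of_lt_of_le (by positivity) (hl k)
  have hc0 : 0 < c := lt_of_lt_of_le (by positivity) hc
  have e : ∑ k, lam k ^ 2 * tval i lam k - c ^ 2 * ((n:ℝ) - i) =
      2 * c * (∑ k, (lam k - c) * tval i lam k) + ∑ k, (lam k - c)^2 * tval i lam k := by
    rw [← tval_sum hi hl0, Finset.mul_sum, Finset.mul_sum, ← Finset.sum_sub_distrib,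
      ← Finset.sum_add_distrib]
    refine Finset.sum_congr rfl fun k _ => by ring
  rw [e]
  have h1 := tval_bounds hi hC hl hc hc2 hsum
  have h2 : |2 * c * (∑ k, (lam k - c) * tval i lam k)| ≤
      2 * C * ((C ^ 3 + C) * ∑ k, (lam k - c) ^ 2) := by
    rw [abs_mul, abs_of_pos (by positivity)]
    exact mul_le_mul (by linarith) h1 (abs_nonneg _) (by positivity)
  have h3 : |∑ k, (lam k - c)^2 * tval i lam k| ≤ ∑ k, (lam k - c) ^ 2 := by
    rw [abs_of_nonneg (Finset.sum_nonneg fun k _ => mul_nonneg (sq_nonneg _) (tval_nonneg hi hl0 k))]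
    exact Finset.sum_le_sum fun k _ => mul_le_of_le_one_right (sq_nonneg _) (tval_le_one hi hl0 k)
  refine (abs_add_le _ _).trans ?_
  linarith

lemma integral_mp {α β F : Type*} [MeasurableSpace α] [MeasurableSpace β] [NormedAddCommGroup F]
    [NormedSpace ℝ F] {μ : Measure α} {ν : Measure β} {g : α → β} (h : MeasurePreserving g μ ν)
    {f : β → F} (hf : AEStronglyMeasurable f ν) : ∫ x, f (g x) ∂μ = ∫ y, f y ∂ν := by
  rw [← h.map_eq] at hf ⊢
  exact (integral_map h.measurable.aemeasurable hf).symm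

lemma spectral_real {n : ℕ} {M : Matrix (Fin n) (Fin n) ℝ} (hM : M.IsHermitian) :
    ∃ W : Matrix (Fin n) (Fin n) ℝ, Wᵀ * W = 1 ∧ Wᵀ * M * W = Matrix.diagonal hM.eigenvalues := by
  refine ⟨hM.eigenvectorUnitary, ?_, ?_⟩
  · have := Unitary.coe_star_mul_self hM.eigenvectorUnitary
    simpa [star_eq_conjTranspose] using this
  · have := hM.conjStarAlgAut_star_eigenvectorUnitary
    rw [Unitary.conjStarAlgAut_star_apply] at this
    simpa [star_eq_conjTranspose, Function.comp_def] using this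

lemma exists_rot {n : ℕ} (A : Matrix (Fin n) (Fin n) ℝ) (lam : Fin n → ℝ)
    (hl : IsOrderedEigenvalues (A * Aᵀ) lam) (hpos : ∀ k, 0 < lam k) :
    ∃ U : Matrix (Fin n) (Fin n) ℝ, Uᵀ * U = 1 ∧ Aᵀ * A = Uᵀ * Matrix.diagonal lam * U := by
  obtain ⟨_, hM, σ, hσ⟩ := hl
  obtain ⟨W, hW, hD⟩ := spectral_real hM
  have hWW : W * Wᵀ = 1 := mul_eq_one_comm.1 hW
  set B : Matrix (Fin n) (Fin n) ℝ := (Wᵀ * A).submatrix σ id with hB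
  have hBB : B * Bᵀ = Matrix.diagonal lam := by
    have h1 : B * Bᵀ = ((Wᵀ * A) * (Wᵀ * A)ᵀ).submatrix σ σ := by
      rw [hB, transpose_submatrix]
      exact submatrix_mul_equiv _ _ σ (Equiv.refl _) σ
    rw [h1, transpose_mul, transpose_transpose, show Wᵀ * A * (Aᵀ * W) = Wᵀ * (A * Aᵀ) * W by
      simp only [Matrix.mul_assoc], hD, hσ]
    ext i j
    simp [Matrix.diagonal_apply]
  have hB2 : Bᵀ * B = Aᵀ * A := by
    have h1 : Bᵀ * B = (Wᵀ * A)ᵀ * (Wᵀ * A) := by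
      rw [hB, transpose_submatrix]
      exact submatrix_mul_equiv _ _ id σ id
    rw [h1, transpose_mul, transpose_transpose, show Aᵀ * W * (Wᵀ * A) = Aᵀ * (W * Wᵀ) * A by
      simp only [Matrix.mul_assoc], hWW, Matrix.mul_one]
  set s : Fin n → ℝ := fun k => (Real.sqrt (lam k))⁻¹ with hs
  refine ⟨Matrix.diagonal s * B, ?_, ?_⟩
  · rw [mul_eq_one_comm, transpose_mul, diagonal_transpose,
      show diagonal s * B * (Bᵀ * diagonal s) = diagonal s * (B * Bᵀ) * diagonal s by
      simp only [Matrix.mul_assoc], hBB, diagonal_mul_diagonal, diagonal_mul_diagonal,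
      ← diagonal_one]
    congr 1
    ext k
    have := Real.sq_sqrt (hpos k).le
    have h2 := Real.sqrt_pos.2 (hpos k)
    simp only [hs]
    field_simp
    exact this.symm
  · rw [transpose_mul, diagonal_transpose,
      show Bᵀ * diagonal s * diagonal lam * (diagonal s * B) =
        Bᵀ * (diagonal s * diagonal lam * diagonal s) * B by simp only [Matrix.mul_assoc],
      diagonal_mul_diagonal, diagonal_mul_diagonal, ← hB2]
    have : (diagonal fun i => s i * lam i * s i) = 1 := by
      rw [← diagonal_one]
      congr 1
      ext k
      have := Real.sq_sqrt (hpos k).le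
      have h2 := Real.sqrt_pos.2 (hpos k)
      simp only [hs]
      field_simp
      exact this.symm
    rw [this, Matrix.mul_one]

lemma Bm_apply {n i : ℕ} (lam : Fin n → ℝ) (w : Fin n → Fin i → ℝ) (a b : Fin i) :
    Bm lam w a b = ∑ k, lam k * (w k a * w k b) := by
  simp [Bm, Matrix.sum_apply, vecMulVec_apply]

lemma logDetYY_eq {n p : ℕ} (A U : Matrix (Fin n) (Fin n) ℝ) (lam : Fin n → ℝ)
    (hU : Aᵀ * A = Uᵀ * Matrix.diagonal lam * U) (ω : Fin p → Fin n → ℝ) :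
    logDetYY n p A ω = Real.log (Bm lam (fun k j => (U *ᵥ ω j) k)).det := by
  unfold logDetYY
  congr 2
  ext i j
  rw [Bm_apply, Matrix.mul_apply]
  have h1 : ∑ k, (Matrix.of (fun i => A.mulVec (ω i))) i k *
      (Matrix.of (fun i => A.mulVec (ω i)))ᵀ k j = (A *ᵥ ω i) ⬝ᵥ (A *ᵥ ω j) := rfl
  rw [h1, dotProduct_mulVec, vecMul_mulVec, hU, ← dotProduct_mulVec,
    ← Matrix.mulVec_mulVec, ← Matrix.mulVec_mulVec, dotProduct_mulVec, vecMul_transpose, dotProduct]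
  refine Finset.sum_congr rfl fun k _ => ?_
  rw [mulVec_diagonal]; ring

noncomputable def ldB {n p : ℕ} (lam : Fin n → ℝ) (ω : Fin p → Fin n → ℝ) : ℝ :=
  Real.log (Bm lam (fun k j => ω j k)).det

lemma measurable_ldB {n p : ℕ} (lam : Fin n → ℝ) : Measurable (ldB (p := p) lam) := by
  unfold ldB
  refine Real.measurable_log.comp (measurable_det_of fun a b => ?_)
  simp only [Bm_apply]
  fun_prop

lemma integral_logDetYY {n p : ℕ} (A : Matrix (Fin n) (Fin n) ℝ) (lam : Fin n → ℝ)
    (hl : IsOrderedEigenvalues (A * Aᵀ) lam) (hpos : ∀ k, 0 < lam k) (f : ℝ → ℝ)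
    (hf : Measurable f) :
    ∫ ω, f (logDetYY n p A ω) ∂(Measure.pi fun _ : Fin p => uniformSphere n) =
    ∫ ω, f (ldB lam ω) ∂(Measure.pi fun _ : Fin p => uniformSphere n) := by
  obtain ⟨U, hU, hA⟩ := exists_rot A lam hl hpos
  have h := pi_rot (p := p) (uniformSphere_rot hU)
  rw [← integral_mp h (f := fun ω => f (ldB lam ω))
    (hf.comp (measurable_ldB lam)).aestronglyMeasurable]
  refine integral_congr_ae (Eventually.of_forall fun ω => ?_)
  simp only [logDetYY_eq A U lam hA]
  rfl

lemma uniformSphere_perm {n : ℕ} (σ : Equiv.Perm (Fin n)) :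
    MeasurePreserving (fun x : Fin n → ℝ => fun k => x (σ k)) (uniformSphere n) (uniformSphere n) := by
  have h := pi_map_comp_inj (gaussianReal 0 1) σ σ.injective
  refine ⟨by fun_prop, ?_⟩
  unfold uniformSphere
  rw [Measure.map_map (by fun_prop) measurable_normalize]
  conv_rhs => rw [gaussianPi, ← h.map_eq, Measure.map_map measurable_normalize (by fun_prop)]
  rw [gaussianPi]
  congr 1
  ext x k
  have : euclidNorm (fun j => x (σ j)) = euclidNorm x := by
    unfold euclidNorm
    rw [Equiv.sum_comp σ fun j => x j ^ 2]
  simp [this]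

lemma exists_perm_pair {n : ℕ} {j k j' k' : Fin n} (h : j ≠ k) (h' : j' ≠ k') :
    ∃ σ : Equiv.Perm (Fin n), σ j = j' ∧ σ k = k' := by
  refine ⟨(Equiv.swap j j').trans (Equiv.swap (Equiv.swap j j' k) k'), ?_, ?_⟩
  · simp only [Equiv.trans_apply, Equiv.swap_apply_left]
    apply Equiv.swap_apply_of_ne_of_ne
    · intro h2
      have : Equiv.swap j j' j = Equiv.swap j j' k := by rw [← h2, Equiv.swap_apply_left]
      exact h ((Equiv.swap j j').injective this)
    · exact h'
  · simp

lemma quad_exch {n : ℕ} (F : Fin n → Fin n → ℝ) (B : ℝ) (hF0 : ∀ j k, 0 ≤ F j k)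
    (hFB : ∀ k, F k k ≤ B)
    (hF : ∀ (σ : Equiv.Perm (Fin n)) j k, F (σ j) (σ k) = F j k) (d : Fin n → ℝ)
    (hd : ∑ k, d k = 0) : ∑ j, ∑ k, d j * d k * F j k ≤ B * ∑ k, d k ^ 2 := by
  obtain ⟨a, ha0, ha⟩ : ∃ a, 0 ≤ a ∧ ∀ j k, j ≠ k → F j k = a := by
    by_cases h : ∃ j k : Fin n, j ≠ k
    · obtain ⟨j, k, hjk⟩ := h
      refine ⟨F j k, hF0 _ _, fun j' k' h' => ?_⟩
      obtain ⟨σ, h1, h2⟩ := exists_perm_pair hjk h'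
      rw [← h1, ← h2, hF]
    · push Not at h
      exact ⟨0, le_rfl, fun j k hjk => absurd (h j k) hjk⟩
  have e : ∀ j k, d j * d k * F j k = a * (d j * d k) +
      (if j = k then d j ^ 2 * (F j j - a) else 0) := by
    intro j k
    split_ifs with h
    · subst h; ring
    · rw [ha j k h]; ring
  simp_rw [e, Finset.sum_add_distrib, ← Finset.mul_sum, hd]
  simp only [mul_zero, Finset.sum_const_zero, zero_add, Finset.sum_ite_eq, Finset.mem_univ, if_true]
  rw [Finset.mul_sum]
  refine Finset.sum_le_sum fun k _ => ?_
  rw [mul_comm]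
  exact mul_le_mul_of_nonneg_right (by linarith [hFB k]) (sq_nonneg _)

lemma T0_sq {n p : ℕ} (hp : p ≤ n) {C c : ℝ} (hC : 0 < C) (hc : C⁻¹ ≤ c) (d : Fin n → ℝ)
    (hd : ∑ k, d k = 0) :
    ∫ ω, (∑ k, d k * av (fun _ => c) (fun k j => ω j k) k k) ^ 2
      ∂(Measure.pi fun _ : Fin p => uniformSphere n) ≤ C ^ 2 * ∑ k, d k ^ 2 := by
  have hc0 : 0 < c := lt_of_lt_of_le (by positivity) hc
  set μ := (Measure.pi fun _ : Fin p => uniformSphere n) with hμ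
  set P : Fin n → (Fin p → Fin n → ℝ) → ℝ := fun k ω => av (fun _ => c) (fun k j => ω j k) k k with hP
  have hPm : ∀ k, Measurable (P k) := fun k =>
    (measurable_av (i := p) (fun _ : Fin n => c) k k).comp
      (by fun_prop : Measurable fun (ω : Fin p → Fin n → ℝ) => fun k j => ω j k)
  have hP0 : ∀ᵐ ω ∂μ, ∀ k, 0 ≤ P k ω ∧ P k ω ≤ C := by
    filter_upwards [ae_Sp_sphere hp] with ω hω k
    have h1 := av_nonneg (lam := fun _ => c) (fun _ => hc0) hω k
    have h2 := av_le (lam := fun _ => c) (fun _ => hc0) hω k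
    refine ⟨h1, ?_⟩
    have h3 := (mul_le_mul_of_nonneg_right hc h1).trans h2
    rwa [inv_mul_le_iff₀ hC, mul_one] at h3
  have hinteg : ∀ j k, Integrable (fun ω => P j ω * P k ω) μ := fun j k => by
    refine Integrable.of_bound (C := C ^ 2) ((hPm j).mul (hPm k)).aestronglyMeasurable ?_
    filter_upwards [hP0] with ω hω
    rw [Real.norm_of_nonneg (mul_nonneg (hω j).1 (hω k).1), sq]
    exact mul_le_mul (hω j).2 (hω k).2 (hω k).1 hC.le
  have e : ∫ ω, (∑ k, d k * P k ω) ^ 2 ∂μ = ∑ j, ∑ k, d j * d k * ∫ ω, P j ω * P k ω ∂μ := by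
    have hint2 : ∀ j k, Integrable (fun ω => d j * P j ω * (d k * P k ω)) μ := fun j k => by
      refine ((hinteg j k).const_mul (d j * d k)).congr (Eventually.of_forall fun ω => ?_)
      simp only; ring
    simp_rw [sq, Finset.sum_mul_sum]
    rw [integral_finsetSum _ fun j _ => integrable_finsetSum _ fun k _ => hint2 j k]
    refine Finset.sum_congr rfl fun j _ => ?_
    rw [integral_finsetSum _ fun k _ => hint2 j k]
    refine Finset.sum_congr rfl fun k _ => ?_
    rw [← integral_const_mul]
    congr 1; ext ω; ring
  change ∫ ω, (∑ k, d k * P k ω) ^ 2 ∂μ ≤ _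
  rw [e]
  refine quad_exch _ _ (fun j k => ?_) (fun k => ?_) (fun σ j k => ?_) d hd
  · refine integral_nonneg_of_ae ?_
    filter_upwards [hP0] with ω hω
    exact mul_nonneg (hω j).1 (hω k).1
  · have : ∫ ω, C ^ 2 ∂μ = C ^ 2 := by simp
    rw [← this]
    refine integral_mono_ae (hinteg k k) (integrable_const _) ?_
    filter_upwards [hP0] with ω hω
    simp only [sq]
    exact mul_le_mul (hω k).2 (hω k).2 (hω k).1 hC.le
  · have h := pi_rot (p := p) (uniformSphere_perm σ)
    refine Eq.trans ?_ (integral_mp h (f := fun ω => P j ω * P k ω)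
      ((hPm j).mul (hPm k)).aestronglyMeasurable)
    refine integral_congr_ae (Eventually.of_forall fun ω => ?_)
    have := fun k => av_const_perm c (fun k j => ω j k) σ k k
    simp only [hP]
    rw [← this, ← this]

lemma Bm_const {n i : ℕ} (c : ℝ) (w : Fin n → Fin i → ℝ) :
    Bm (fun _ => c) w = c • Bm (fun _ => 1) w := by
  simp [Bm, Finset.smul_sum]

lemma ldB_L1 {n p : ℕ} (hp : p ≤ n) {C c : ℝ} (hC : 0 < C) (hc : C⁻¹ ≤ c) {lam : Fin n → ℝ}
    (hl : ∀ k, C⁻¹ ≤ lam k) (hd : ∑ k, (lam k - c) = 0) :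
    ∃ Z : (Fin p → Fin n → ℝ) → ℝ, Integrable Z (Measure.pi fun _ : Fin p => uniformSphere n) ∧
      (∀ᵐ ω ∂(Measure.pi fun _ : Fin p => uniformSphere n),
        |ldB lam ω - (p * Real.log c + ldB (fun _ => 1) ω)| ≤ Z ω) ∧
      ∫ ω, Z ω ∂(Measure.pi fun _ : Fin p => uniformSphere n) ≤
        C ^ 2 * ∑ k, (lam k - c) ^ 2 + C * Real.sqrt (∑ k, (lam k - c) ^ 2) := by
  have hl0 : ∀ k, 0 < lam k := fun k => lt_of_lt_of_le (by positivity) (hl k)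
  have hc0 : 0 < c := lt_of_lt_of_le (by positivity) hc
  set μ := (Measure.pi fun _ : Fin p => uniformSphere n) with hμ
  set S := ∑ k, (lam k - c) ^ 2 with hS
  set T : (Fin p → Fin n → ℝ) → ℝ := fun ω =>
    ∑ k, (lam k - c) * av (fun _ => c) (fun k j => ω j k) k k with hT
  have hTm : Measurable T := by
    refine Finset.measurable_sum _ fun k _ => Measurable.const_mul ?_ _
    exact (measurable_av (i := p) (fun _ : Fin n => c) k k).comp
      (by fun_prop : Measurable fun (ω : Fin p → Fin n → ℝ) => fun k j => ω j k)
  have hTb : ∃ K, ∀ᵐ ω ∂μ, ‖T ω‖ ≤ K := by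
    refine ⟨∑ k, |lam k - c| * C, ?_⟩
    filter_upwards [ae_Sp_sphere hp] with ω hω
    refine (norm_sum_le _ _).trans (Finset.sum_le_sum fun k _ => ?_)
    have h1 := av_nonneg (lam := fun _ => c) (fun _ => hc0) hω k
    have h2 := av_le (lam := fun _ => c) (fun _ => hc0) hω k
    rw [norm_mul, Real.norm_eq_abs, Real.norm_of_nonneg h1]
    refine mul_le_mul_of_nonneg_left ?_ (abs_nonneg _)
    have h3 := (mul_le_mul_of_nonneg_right hc h1).trans h2
    rwa [inv_mul_le_iff₀ hC, mul_one] at h3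
  obtain ⟨K, hK⟩ := hTb
  have hTL : MemLp T 2 μ := MemLp.of_bound hTm.aestronglyMeasurable K hK
  have hTi : Integrable T μ := hTL.integrable (by norm_num)
  have hTabs : ∫ ω, |T ω| ∂μ ≤ C * Real.sqrt S := by
    have hv := variance_nonneg (|T|) μ
    rw [variance_eq_sub hTL.abs] at hv
    have h2 := T0_sq hp hC hc (fun k => lam k - c) hd
    have h3 : ∫ ω, (fun ω => |T ω|) ω ^ 2 ∂μ ≤ C ^ 2 * S := by
      simpa only [sq_abs] using h2
    have h4 : (∫ ω, |T ω| ∂μ) ^ 2 ≤ C ^ 2 * S := by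
      have : (∫ ω, ((|T|) ^ 2) ω ∂μ) = ∫ ω, (fun ω => |T ω|) ω ^ 2 ∂μ := rfl
      have h6 : (∫ ω, |T| ω ∂μ) = ∫ ω, |T ω| ∂μ := rfl
      rw [this, h6] at hv
      linarith
    have h5 := Real.le_sqrt_of_sq_le h4
    rwa [Real.sqrt_mul (by positivity), Real.sqrt_sq hC.le] at h5
  refine ⟨fun ω => C ^ 2 * S + |T ω|, (integrable_const _).add hTi.abs, ?_, ?_⟩
  · filter_upwards [ae_Sp_sphere hp] with ω hω
    have h := logdet_diff (kap := fun _ => c) hC hl (fun _ => hc) hω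
    have hdet : Real.log (Bm (fun _ => c) (fun k j => ω j k)).det =
        p * Real.log c + ldB (fun _ => 1) ω := by
      have h1 := (Bm_posDef (lam := fun _ => (1:ℝ)) (fun _ => one_pos) hω).det_pos
      rw [Bm_const, det_smul, Real.log_mul (by simp; intro h; linarith) h1.ne', Real.log_pow]
      simp [ldB]
    rw [hdet] at h
    have e : ldB lam ω - (p * Real.log c + ldB (fun _ => 1) ω) =
      (Real.log (Bm lam (fun k j => ω j k)).det - (p * Real.log c + ldB (fun _ => 1) ω) - T ω) + T ω := by
      unfold ldB; ring
    rw [e]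
    exact (abs_add_le _ _).trans (by linarith)
  · rw [integral_add (integrable_const _) hTi.abs]
    simp only [integral_const, probReal_univ, smul_eq_mul, one_mul]
    linarith

lemma polar_prod {n : ℕ} (hn : 1 ≤ n) (H : EuclideanSpace ℝ (Fin n) → ℂ) (K : ℝ → ℂ) :
    ∫ x : EuclideanSpace ℝ (Fin n), H (‖x‖⁻¹ • x) * K ‖x‖ =
      (∫ z : Metric.sphere (0 : EuclideanSpace ℝ (Fin n)) 1, H z
        ∂(volume : Measure (EuclideanSpace ℝ (Fin n))).toSphere) *
      ∫ r : Set.Ioi (0:ℝ), K r ∂(Measure.volumeIoiPow (n - 1)) := by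
  have : Nonempty (Fin n) := ⟨⟨0, by omega⟩⟩
  have : Nontrivial (EuclideanSpace ℝ (Fin n)) := inferInstance
  set μ : Measure (EuclideanSpace ℝ (Fin n)) := volume with hμ
  have hd : Module.finrank ℝ (EuclideanSpace ℝ (Fin n)) = n := by simp
  calc
    ∫ x : EuclideanSpace ℝ (Fin n), H (‖x‖⁻¹ • x) * K ‖x‖ =
      ∫ x : ({(0)}ᶜ : Set (EuclideanSpace ℝ (Fin n))), H (‖x.1‖⁻¹ • x.1) * K ‖x.1‖ ∂(μ.comap (↑)) := by
      rw [integral_subtype_comap (measurableSet_singleton _).compl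
        fun x : EuclideanSpace ℝ (Fin n) ↦ H (‖x‖⁻¹ • x) * K ‖x‖, restrict_compl_singleton]
    _ = ∫ x, H x.1 * K x.2 ∂μ.toSphere.prod (.volumeIoiPow (n - 1)) := by
      have h := μ.measurePreserving_homeomorphUnitSphereProd
      rw [hd] at h
      rw [← h.integral_comp (Homeomorph.measurableEmbedding _)]
      simp
    _ = _ := integral_prod_mul (fun z : Metric.sphere (0 : EuclideanSpace ℝ (Fin n)) 1 => H z)
        (fun r : Set.Ioi (0:ℝ) => K r)

lemma euclidNorm_eq {n : ℕ} (x : EuclideanSpace ℝ (Fin n)) : euclidNorm (WithLp.ofLp x) = ‖x‖ := by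
  rw [EuclideanSpace.norm_eq, euclidNorm]
  simp

lemma integral_uniformSphere {n : ℕ} {h : (Fin n → ℝ) → ℂ} (hh : Measurable h) :
    ∫ u, h u ∂(uniformSphere n) = ∫ x, h ((euclidNorm x)⁻¹ • x) ∂(gaussianPi n) := by
  unfold uniformSphere
  rw [integral_map measurable_normalize.aemeasurable hh.aestronglyMeasurable]

lemma polar_indep {n : ℕ} (hn : 1 ≤ n) {h : (Fin n → ℝ) → ℂ} (hh : Measurable h) (κ : ℝ → ℂ) :
    ∫ x, h ((euclidNorm x)⁻¹ • x) * κ (euclidNorm x) ∂(gaussianPi n) =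
      (∫ u, h u ∂(uniformSphere n)) * ∫ x, κ (euclidNorm x) ∂(gaussianPi n) := by
  set G : ℝ → ℝ := fun r => ((2 * Real.pi) ^ ((n : ℝ) / 2))⁻¹ * Real.exp (-r ^ 2 / 2) with hG
  have key : ∀ (h : (Fin n → ℝ) → ℂ) (κ : ℝ → ℂ),
      ∫ x, h ((euclidNorm x)⁻¹ • x) * κ (euclidNorm x) ∂(gaussianPi n) =
      (∫ z : Metric.sphere (0 : EuclideanSpace ℝ (Fin n)) 1, h (WithLp.ofLp z.1)
        ∂(volume : Measure (EuclideanSpace ℝ (Fin n))).toSphere) *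
      ∫ r : Set.Ioi (0:ℝ), (G r : ℂ) * κ r ∂(Measure.volumeIoiPow (n - 1)) := by
    intro h κ
    rw [integral_gaussianPi, ← polar_prod hn (fun x => h (WithLp.ofLp x)) (fun r => (G r : ℂ) * κ r)]
    congr 1
    ext x
    rw [euclidNorm_eq, Complex.real_smul, WithLp.ofLp_smul]
    simp only [gdens, hG]
    ring
  rw [integral_uniformSphere hh]
  have k1 := key h κ
  have k2 := key h (fun _ => 1)
  have k3 := key (fun _ => 1) κ
  have k4 := key (fun _ => 1) (fun _ => 1)
  simp only [mul_one, one_mul] at k2 k3 k4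
  rw [show ∫ x : Fin n → ℝ, (1:ℂ) ∂(gaussianPi n) = 1 by simp] at k4
  rw [k1, k2, k3]
  linear_combination ((∫ z : Metric.sphere (0 : EuclideanSpace ℝ (Fin n)) 1, h (WithLp.ofLp z.1)
        ∂(volume : Measure (EuclideanSpace ℝ (Fin n))).toSphere) *
      ∫ r : Set.Ioi (0:ℝ), (G r : ℂ) * κ r ∂(Measure.volumeIoiPow (n - 1))) * k4

noncomputable def chi (m : ℕ) (τ : ℝ) : ℂ :=
  Complex.exp (τ * Real.log 2 * Complex.I) * Complex.Gamma (m / 2 + τ * Complex.I) /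
    Complex.Gamma (m / 2)

noncomputable def Jint (m : ℕ) (τ : ℝ) : ℂ :=
  ∫ y in Set.Ioi (0:ℝ), y ^ (m - 1) • ((Real.exp (-y ^ 2 / 2) : ℂ) *
    Complex.exp (τ * Real.log (y ^ 2) * Complex.I))

lemma Jint_eq {m : ℕ} (hm : 1 ≤ m) (τ : ℝ) :
    Jint m τ = (1/2) * ((2:ℂ) ^ ((m:ℂ)/2) * Complex.exp (τ * Real.log 2 * Complex.I) *
      Complex.Gamma (m / 2 + τ * Complex.I)) := by
  have h1 := Complex.integral_cpow_mul_exp_neg_mul_Ioi (a := m / 2 + τ * Complex.I) (r := 1/2)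
    (by simp; omega) (by norm_num)
  have h2 := integral_comp_rpow_Ioi_of_pos (p := 2) (by norm_num)
    (g := fun t : ℝ => (1/2 : ℂ) * ((t : ℂ) ^ ((m / 2 + τ * Complex.I : ℂ) - 1) *
      Complex.exp (-((1/2 : ℝ) * t))))
  rw [integral_const_mul, h1] at h2
  have h3 : ((1:ℂ) / ((1/2 : ℝ):ℂ)) ^ ((m:ℂ) / 2 + τ * Complex.I) =
      (2:ℂ) ^ ((m:ℂ)/2) * Complex.exp (τ * Real.log 2 * Complex.I) := by
    have : (1:ℂ) / ((1/2 : ℝ):ℂ) = 2 := by push_cast; norm_num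
    rw [this, Complex.cpow_add _ _ (by norm_num)]
    congr 1
    rw [Complex.cpow_def_of_ne_zero (by norm_num)]
    congr 1
    rw [Complex.ofReal_log (by norm_num)]
    push_cast
    ring
  rw [h3] at h2
  rw [← h2, Jint]
  refine setIntegral_congr_fun measurableSet_Ioi fun y hy => ?_
  have hy0 : (0:ℝ) < y := hy
  simp only [Complex.real_smul]
  have e1 : (y:ℝ) ^ (2:ℝ) = y ^ 2 := by norm_cast
  have e2 : (y:ℝ) ^ ((2:ℝ) - 1) = y := by norm_num
  rw [e1, e2]
  have e3 : (((y ^ 2 : ℝ)) : ℂ) ^ ((m / 2 + τ * Complex.I : ℂ) - 1) =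
      (y:ℂ)^(m - 1) * (y:ℂ)⁻¹ * Complex.exp (τ * Real.log (y ^ 2) * Complex.I) := by
    have hy2 : (((y ^ 2 : ℝ)) : ℂ) ≠ 0 := by
      simp [hy0.ne']
    have hyc : (y:ℂ) ≠ 0 := by simp [hy0.ne']
    rw [show (m / 2 + τ * Complex.I : ℂ) - 1 = ((m / 2 - 1 : ℝ) : ℂ) + τ * Complex.I by
      push_cast; ring, Complex.cpow_add _ _ hy2]
    congr 1
    · rw [← Complex.ofReal_cpow (by positivity)]
      have : (y ^ 2 : ℝ) ^ ((m:ℝ) / 2 - 1) = y ^ (m - 1) * y⁻¹ := by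
        rw [← e1, ← Real.rpow_mul hy0.le]
        rw [show (2:ℝ) * ((m:ℝ)/2 - 1) = ((m - 1 : ℕ) : ℝ) + (-1 : ℝ) by
          push_cast [Nat.cast_sub hm]; ring, Real.rpow_add hy0, Real.rpow_natCast,
          Real.rpow_neg_one]
      rw [this]; push_cast; rfl
    · rw [Complex.cpow_def_of_ne_zero hy2, ← Complex.ofReal_log (by positivity)]
      congr 1
      ring
  rw [e3]
  have hyc : (y:ℂ) ≠ 0 := by simp [hy0.ne']
  push_cast
  rw [show -(1 / 2 * (y:ℂ)^2) = -(y:ℂ)^2/2 by ring]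
  field_simp

lemma gamma_half_ne {m : ℕ} (hm : 1 ≤ m) : Complex.Gamma ((m:ℂ) / 2) ≠ 0 :=
  Complex.Gamma_ne_zero_of_re_pos (by simp; omega)

lemma gaussian_norm_chi {m : ℕ} (hm : 1 ≤ m) (τ : ℝ) :
    ∫ x, Complex.exp (τ * Real.log (euclidNorm x ^ 2) * Complex.I) ∂(gaussianPi m) = chi m τ := by
  have : Nonempty (Fin m) := ⟨⟨0, by omega⟩⟩
  have : Nontrivial (EuclideanSpace ℝ (Fin m)) := inferInstance
  obtain ⟨K, hK⟩ : ∃ K : ℂ, ∀ τ : ℝ,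
      ∫ x, Complex.exp (τ * Real.log (euclidNorm x ^ 2) * Complex.I) ∂(gaussianPi m) =
        K * Jint m τ := by
    refine ⟨((((2 * Real.pi) ^ ((m : ℝ) / 2))⁻¹ : ℝ) : ℂ) * m *
      ((volume : Measure (EuclideanSpace ℝ (Fin m))).real (Metric.ball 0 1) : ℂ), fun τ => ?_⟩
    have h := integral_fun_norm_addHaar (volume : Measure (EuclideanSpace ℝ (Fin m)))
      (fun y => ((Real.exp (-y ^ 2 / 2) : ℂ) *
        Complex.exp (τ * Real.log (y ^ 2) * Complex.I)))
    rw [integral_gaussianPi]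
    have e : ∀ x : EuclideanSpace ℝ (Fin m), gdens m x •
        Complex.exp (τ * Real.log (euclidNorm (WithLp.ofLp x) ^ 2) * Complex.I) =
        ((((2 * Real.pi) ^ ((m : ℝ) / 2))⁻¹ : ℝ) : ℂ) * ((Real.exp (-‖x‖ ^ 2 / 2) : ℂ) *
        Complex.exp (τ * Real.log (‖x‖ ^ 2) * Complex.I)) := by
      intro x
      rw [euclidNorm_eq, Complex.real_smul, gdens]
      push_cast
      ring
    simp_rw [e]
    rw [integral_const_mul, h]
    simp only [finrank_euclideanSpace, Fintype.card_fin, Complex.real_smul, nsmul_eq_mul, Jint]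
    ring
  have h0 := hK 0
  have h1 := hK τ
  simp only [Complex.ofReal_zero, zero_mul, Complex.exp_zero, integral_const, probReal_univ,
    one_smul] at h0
  rw [Jint_eq hm] at h0 h1
  simp only [Complex.ofReal_zero, zero_mul, Complex.exp_zero, add_zero, mul_one] at h0
  rw [h1, chi]
  have hg := gamma_half_ne hm
  rw [eq_div_iff hg]
  linear_combination (-(Complex.exp (τ * Real.log 2 * Complex.I) *
    Complex.Gamma (m / 2 + τ * Complex.I))) * h0

lemma chi_ne {m : ℕ} (hm : 1 ≤ m) (τ : ℝ) : chi m τ ≠ 0 := by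
  unfold chi
  refine div_ne_zero (mul_ne_zero (Complex.exp_ne_zero _) ?_) (gamma_half_ne hm)
  exact Complex.Gamma_ne_zero_of_re_pos (by simp; omega)

lemma sphere_partial_chi {m n : ℕ} (hm : 1 ≤ m) (hn : 1 ≤ n) (e : Fin m → Fin n)
    (he : Function.Injective e) (τ : ℝ) :
    ∫ u, Complex.exp (τ * Real.log (∑ j, u (e j) ^ 2) * Complex.I) ∂(uniformSphere n) =
      chi m τ / chi n τ := by
  have hmeas : Measurable fun u : Fin n → ℝ =>
      Complex.exp (τ * Real.log (∑ j, u (e j) ^ 2) * Complex.I) := by fun_prop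
  have h1 := polar_indep hn hmeas
    (fun r => Complex.exp (τ * Real.log (r ^ 2) * Complex.I))
  rw [gaussian_norm_chi hn] at h1
  rw [eq_div_iff (chi_ne hn τ), ← h1, ← gaussian_norm_chi hm]
  have hmp := pi_map_comp_inj (gaussianReal 0 1) e he
  have h2 := integral_mp hmp (f := fun x : Fin m → ℝ =>
      Complex.exp (τ * Real.log (euclidNorm x ^ 2) * Complex.I))
      (Measurable.aestronglyMeasurable (by have := measurable_euclidNorm (n := m); fun_prop))
  unfold gaussianPi at *
  rw [← h2]
  refine integral_congr_ae ?_
  have hne : ∀ᵐ x ∂(gaussianPi n), x ⬝ᵥ Pi.single (e ⟨0, by omega⟩) 1 ≠ 0 :=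
    gaussianPi_hyperplane _ (by simp)
  filter_upwards [hne] with x hx
  have hx1 : x (e ⟨0, by omega⟩) ≠ 0 := by simpa using hx
  have hN : 0 < ∑ j, x j ^ 2 := Finset.sum_pos' (fun _ _ => sq_nonneg _)
    ⟨_, Finset.mem_univ _, by positivity⟩
  have hM : 0 < ∑ j, x (e j) ^ 2 := Finset.sum_pos' (fun _ _ => sq_nonneg _)
    ⟨⟨0, by omega⟩, Finset.mem_univ _, by positivity⟩
  rw [← Complex.exp_add]
  congr 1
  have hE : euclidNorm x ^ 2 = ∑ j, x j ^ 2 := by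
    unfold euclidNorm; rw [Real.sq_sqrt hN.le]
  have hE2 : euclidNorm (fun j => x (e j)) ^ 2 = ∑ j, x (e j) ^ 2 := by
    unfold euclidNorm; rw [Real.sq_sqrt hM.le]
  rw [hE, hE2]
  have : ∑ j, ((euclidNorm x)⁻¹ • x) (e j) ^ 2 = (∑ j, x (e j) ^ 2) / (∑ j, x j ^ 2) := by
    rw [← hE, Finset.sum_div]
    refine Finset.sum_congr rfl fun j _ => ?_
    simp [mul_pow, div_eq_inv_mul]
  rw [this, Real.log_div hM.ne' hN.ne']
  push_cast
  ring

noncomputable def Gm {n i : ℕ} (w : Fin i → Fin n → ℝ) : Matrix (Fin i) (Fin i) ℝ :=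
  Matrix.of w * (Matrix.of w)ᵀ

lemma Gm_eq {n i : ℕ} (w : Fin i → Fin n → ℝ) : Gm w = Bm (fun _ => 1) (fun k j => w j k) := by
  ext a b
  simp [Gm, Bm_apply, Matrix.mul_apply]

noncomputable def Qm {n i : ℕ} (w : Fin i → Fin n → ℝ) : Matrix (Fin n) (Fin n) ℝ :=
  1 - (Matrix.of w)ᵀ * (Gm w)⁻¹ * Matrix.of w

lemma Sp_of_li {n i : ℕ} {w : Fin i → Fin n → ℝ} (h : LinearIndependent ℝ w) :
    Sp (fun k j => w j k) := by
  intro x hx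
  rw [Fintype.linearIndependent_iff] at h
  ext j
  refine h x ?_ j
  ext k
  simpa [dotProduct, mul_comm] using hx k

lemma Gm_posDef {n i : ℕ} {w : Fin i → Fin n → ℝ} (h : LinearIndependent ℝ w) :
    (Gm w).PosDef := by
  rw [Gm_eq]; exact Bm_posDef (fun _ => one_pos) (Sp_of_li h)

lemma det_Gm_succ {n i : ℕ} (w : Fin (i+1) → Fin n → ℝ)
    (h : LinearIndependent ℝ (fun j : Fin i => w j.castSucc)) :
    (Gm w).det = (Gm fun j : Fin i => w j.castSucc).det *
      (w (Fin.last i) ⬝ᵥ (Qm fun j : Fin i => w j.castSucc) *ᵥ w (Fin.last i)) := by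
  set v : Fin i → Fin n → ℝ := fun j => w j.castSucc with hv
  set u := w (Fin.last i) with hu
  have hG := Gm_posDef h
  have hdet : IsUnit (Gm v).det := hG.det_pos.ne'.isUnit
  have : Invertible (Gm v) := Matrix.invertibleOfIsUnitDet _ hdet
  set V : Matrix (Fin i) (Fin n) ℝ := Matrix.of v with hV
  set R : Matrix (Fin 1) (Fin n) ℝ := Matrix.of fun _ => u with hR
  have e1 : (Gm w).submatrix (finSumFinEquiv (m := i) (n := 1)) (finSumFinEquiv (m := i) (n := 1)) =
      Matrix.fromBlocks (Gm v) (V * Rᵀ) (R * Vᵀ) (R * Rᵀ) := by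
    ext a b
    rcases a with a | a <;> rcases b with b | b
    · simp [Gm, Matrix.mul_apply, hv, Fin.castSucc]
    · have hb : b = 0 := Subsingleton.elim _ _
      subst hb
      simp [Gm, Matrix.mul_apply, hv, hV, hR, hu, Fin.castSucc, Fin.last]
      rfl
    · have hb : a = 0 := Subsingleton.elim _ _
      subst hb
      simp [Gm, Matrix.mul_apply, hv, hV, hR, hu, Fin.castSucc, Fin.last]
      rfl
    · have hb : b = 0 := Subsingleton.elim _ _
      have ha : a = 0 := Subsingleton.elim _ _
      subst hb
      subst ha
      simp [Gm, Matrix.mul_apply, hR, hu, Fin.last]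
      rfl
  rw [← Matrix.det_submatrix_equiv_self (finSumFinEquiv (m := i) (n := 1)) (Gm w), e1,
    Matrix.det_fromBlocks₁₁]
  congr 1
  rw [Matrix.det_fin_one, Matrix.invOf_eq_nonsing_inv]
  have e2 : R * Rᵀ - R * Vᵀ * (Gm v)⁻¹ * (V * Rᵀ) = R * (Qm v * Rᵀ) := by
    rw [Qm, Matrix.sub_mul, Matrix.one_mul, Matrix.mul_sub]
    simp only [Matrix.mul_assoc, hV]
  rw [e2]
  simp [hR, Matrix.mul_apply, dotProduct, mulVec]

lemma Qm_symm {n i : ℕ} {w : Fin i → Fin n → ℝ} (h : LinearIndependent ℝ w) : (Qm w)ᵀ = Qm w := by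
  have h1 : ((Gm w)⁻¹)ᵀ = (Gm w)⁻¹ := by
    rw [Matrix.transpose_nonsing_inv]
    congr 1
    simp [Gm]
  simp [Qm, Matrix.transpose_mul, h1, Matrix.mul_assoc]

lemma Qm_idem {n i : ℕ} {w : Fin i → Fin n → ℝ} (h : LinearIndependent ℝ w) :
    Qm w * Qm w = Qm w := by
  have hdet : IsUnit (Gm w).det := (Gm_posDef h).det_pos.ne'.isUnit
  have : (Matrix.of w)ᵀ * (Gm w)⁻¹ * Matrix.of w * ((Matrix.of w)ᵀ * (Gm w)⁻¹ * Matrix.of w) =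
      (Matrix.of w)ᵀ * (Gm w)⁻¹ * Matrix.of w := by
    have e : (Matrix.of w)ᵀ * (Gm w)⁻¹ * Matrix.of w * ((Matrix.of w)ᵀ * (Gm w)⁻¹ * Matrix.of w) =
      (Matrix.of w)ᵀ * (Gm w)⁻¹ * (Gm w * (Gm w)⁻¹) * Matrix.of w := by
      rw [show Gm w * (Gm w)⁻¹ = Matrix.of w * (Matrix.of w)ᵀ * (Gm w)⁻¹ from rfl]
      simp only [Matrix.mul_assoc]
    rw [e, Matrix.mul_nonsing_inv _ hdet, Matrix.mul_one]
  rw [Qm, Matrix.sub_mul, Matrix.mul_sub, Matrix.mul_sub, this]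
  simp

lemma Qm_trace {n i : ℕ} {w : Fin i → Fin n → ℝ} (h : LinearIndependent ℝ w) :
    (Qm w).trace = (n : ℝ) - i := by
  have hdet : IsUnit (Gm w).det := (Gm_posDef h).det_pos.ne'.isUnit
  rw [Qm, Matrix.trace_sub, Matrix.trace_mul_comm, ← Matrix.mul_assoc,
    show Matrix.of w * (Matrix.of w)ᵀ = Gm w from rfl, Matrix.mul_nonsing_inv _ hdet]
  simp

lemma quad_sphere {n m : ℕ} (hm : 1 ≤ m) (Q : Matrix (Fin n) (Fin n) ℝ) (hs : Qᵀ = Q)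
    (hi : Q * Q = Q) (ht : Q.trace = m) (τ : ℝ) :
    ∫ u, Complex.exp (τ * Real.log (u ⬝ᵥ Q *ᵥ u) * Complex.I) ∂(uniformSphere n) =
      chi m τ / chi n τ := by
  have hH : Q.IsHermitian := by
    rw [Matrix.IsHermitian, Matrix.conjTranspose_eq_transpose_of_trivial]; exact hs
  obtain ⟨W, hW, hD⟩ := spectral_real hH
  have hWW : W * Wᵀ = 1 := mul_eq_one_comm.1 hW
  set ev := hH.eigenvalues with hev
  have hev2 : ∀ k, ev k * ev k = ev k := by
    have : Matrix.diagonal ev * Matrix.diagonal ev = Matrix.diagonal ev := by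
      rw [← hD]
      rw [show Wᵀ * Q * W * (Wᵀ * Q * W) = Wᵀ * Q * (W * Wᵀ) * Q * W by
        simp only [Matrix.mul_assoc], hWW, Matrix.mul_one, Matrix.mul_assoc Wᵀ Q Q, hi]
    rw [diagonal_mul_diagonal] at this
    intro k
    exact congrFun (Matrix.diagonal_injective this) k
  have hev01 : ∀ k, ev k = 0 ∨ ev k = 1 := fun k => by
    have := hev2 k
    rcases eq_or_ne (ev k) 0 with h | h
    · exact Or.inl h
    · right; exact mul_left_cancel₀ h (by rw [this, mul_one])
  set s : Finset (Fin n) := Finset.univ.filter fun k => ev k = 1 with hsdef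
  have hsum : ∀ f : Fin n → ℝ, ∑ k, ev k * f k = ∑ k ∈ s, f k := by
    intro f
    rw [hsdef, Finset.sum_filter]
    refine Finset.sum_congr rfl fun k _ => ?_
    rcases hev01 k with h | h <;> simp [h]
  have hcard : s.card = m := by
    have h1 : Q.trace = ∑ k, ev k := by
      have := hH.trace_eq_sum_eigenvalues
      simpa using this
    have h2 := hsum (fun _ => 1)
    simp only [mul_one, ← h1, ht, Finset.sum_const, nsmul_eq_mul] at h2
    exact_mod_cast h2.symm
  have hn : 1 ≤ n := by
    have := Finset.card_le_univ s
    simp at this; omega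
  let e := s.orderEmbOfFin hcard
  have hQ : ∀ u, u ⬝ᵥ Q *ᵥ u = ∑ j, (Wᵀ *ᵥ u) (e j) ^ 2 := by
    intro u
    have hQ1 : Q = W * Matrix.diagonal ev * Wᵀ := by
      rw [← hD, show W * (Wᵀ * Q * W) * Wᵀ = (W * Wᵀ) * Q * (W * Wᵀ) by
        simp only [Matrix.mul_assoc], hWW, Matrix.one_mul, Matrix.mul_one]
    conv_lhs => rw [hQ1]
    rw [← Matrix.mulVec_mulVec, ← Matrix.mulVec_mulVec, dotProduct_mulVec, ← mulVec_transpose,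
      dotProduct]
    have h1 : ∑ k, (Wᵀ *ᵥ u) k * (diagonal ev *ᵥ Wᵀ *ᵥ u) k = ∑ k, ev k * (Wᵀ *ᵥ u) k ^ 2 :=
      Finset.sum_congr rfl fun k _ => by rw [mulVec_diagonal]; ring
    rw [h1, hsum, ← Finset.sum_coe_sort s]
    exact (Equiv.sum_comp (s.orderIsoOfFin hcard).toEquiv fun k : s => (Wᵀ *ᵥ u) k ^ 2).symm
  have hWt : Wᵀᵀ * Wᵀ = 1 := by rw [transpose_transpose]; exact hWW
  have h1 := integral_mp (uniformSphere_rot hWt) (f := fun u : Fin n → ℝ =>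
    Complex.exp (τ * Real.log (∑ j, u (e j) ^ 2) * Complex.I))
    (Measurable.aestronglyMeasurable (by fun_prop))
  simp_rw [hQ]
  rw [h1]
  exact sphere_partial_chi hm hn e e.injective τ

lemma ldB_snoc {n i : ℕ} (hi : i < n) {w : Fin i → Fin n → ℝ} (h : LinearIndependent ℝ w) :
    ∀ᵐ u ∂(uniformSphere n), ldB (fun _ => 1) (Fin.snoc w u : Fin (i+1) → Fin n → ℝ) =
      ldB (fun _ => 1) w + Real.log (u ⬝ᵥ Qm w *ᵥ u) := by
  have hQ0 : Qm w ≠ 0 := by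
    intro h0
    have := Qm_trace h
    rw [h0, Matrix.trace_zero] at this
    have h2 : (i:ℝ) < n := by exact_mod_cast hi
    linarith
  obtain ⟨k, hk⟩ : ∃ k, Qm w k ≠ 0 := by
    by_contra hc
    push Not at hc
    exact hQ0 (by ext a b; rw [hc a]; rfl)
  filter_upwards [uniformSphere_hyperplane _ hk] with u hu
  have hq : u ⬝ᵥ Qm w *ᵥ u ≠ 0 := by
    have e : u ⬝ᵥ Qm w *ᵥ u = ∑ j, (Qm w *ᵥ u) j ^ 2 := by
      conv_lhs => rw [← Qm_idem h, ← Matrix.mulVec_mulVec, dotProduct_mulVec, ← mulVec_transpose,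
        Qm_symm h]
      simp [dotProduct, sq]
    rw [e]
    have : (Qm w *ᵥ u) k ≠ 0 := by
      rw [dotProduct_comm] at hu
      exact hu
    exact (Finset.sum_pos' (fun _ _ => sq_nonneg _) ⟨k, Finset.mem_univ _, by positivity⟩).ne'
  have e1 : (fun j : Fin i => (Fin.snoc w u : Fin (i+1) → Fin n → ℝ) j.castSucc) = w := by
    ext j; simp
  have hd := det_Gm_succ (Fin.snoc w u : Fin (i+1) → Fin n → ℝ) (by rw [e1]; exact h)
  rw [e1, Fin.snoc_last] at hd
  unfold ldB
  rw [← Gm_eq, ← Gm_eq, hd, Real.log_mul (Gm_posDef h).det_pos.ne' hq]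

lemma ldB_chi {n : ℕ} (τ : ℝ) (i : ℕ) (hi : i ≤ n) :
    ∫ ω, Complex.exp (τ * ldB (fun _ => 1) ω * Complex.I)
      ∂(Measure.pi fun _ : Fin i => uniformSphere n) =
      ∏ j ∈ Finset.range i, chi (n - j) τ / chi n τ := by
  induction i with
  | zero =>
    simp [ldB]
  | succ i ih =>
    rw [Finset.prod_range_succ, ← ih (by omega)]
    have hmp := measurePreserving_piFinSuccAbove (fun _ : Fin (i+1) => uniformSphere n) (Fin.last i)
    have hm : Measurable fun z : (Fin n → ℝ) × (Fin i → Fin n → ℝ) =>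
        Complex.exp (τ * ldB (fun _ => 1) (Fin.snoc z.2 z.1 : Fin (i+1) → Fin n → ℝ) * Complex.I) := by
      have h1 : Measurable fun z : (Fin n → ℝ) × (Fin i → Fin n → ℝ) =>
        (Fin.snoc z.2 z.1 : Fin (i+1) → Fin n → ℝ) := by
        refine measurable_pi_iff.2 fun a => ?_
        refine Fin.lastCases ?_ (fun j => ?_) a
        · simpa using measurable_fst
        · simp only [Fin.snoc_castSucc]; fun_prop
      have h2 := (measurable_ldB (p := i+1) (fun _ : Fin n => (1:ℝ))).comp h1
      exact Complex.measurable_exp.comp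
        (((Complex.measurable_ofReal.comp h2).const_mul _).mul_const _)
    have h1 := hmp.integral_comp' (g := fun z : (Fin n → ℝ) × (Fin i → Fin n → ℝ) =>
        Complex.exp (τ * ldB (fun _ => 1) (Fin.snoc z.2 z.1 : Fin (i+1) → Fin n → ℝ) * Complex.I))
    have h2 : ∀ ω : Fin (i+1) → Fin n → ℝ, (Fin.snoc
        ((MeasurableEquiv.piFinSuccAbove (fun _ : Fin (i+1) => Fin n → ℝ) (Fin.last i)) ω).2
        ((MeasurableEquiv.piFinSuccAbove (fun _ : Fin (i+1) => Fin n → ℝ) (Fin.last i)) ω).1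
         : Fin (i+1) → Fin n → ℝ) = ω := by
      intro ω
      ext a
      refine Fin.lastCases ?_ (fun j => ?_) a <;>
        simp [MeasurableEquiv.piFinSuccAbove, Fin.insertNthEquiv]
      rfl
    simp_rw [h2] at h1
    rw [h1, integral_prod_symm]
    · rw [← integral_mul_const]
      refine integral_congr_ae ?_
      filter_upwards [ae_linearIndependent (uniformSphere n) uniformSphere_hyperplane i (by omega)]
        with w hw
      have hq := quad_sphere (m := n - i) (by omega) (Qm w) (Qm_symm hw) (Qm_idem hw)
        (by rw [Qm_trace hw, Nat.cast_sub (by omega)]) τ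
      rw [← hq, ← integral_const_mul]
      refine integral_congr_ae ?_
      filter_upwards [ldB_snoc (by omega) hw] with u hu
      rw [hu, ← Complex.exp_add]
      congr 1
      push_cast
      ring
    · refine Integrable.of_bound (C := 1) hm.aestronglyMeasurable (Eventually.of_forall fun z => ?_)
      rw [← Complex.ofReal_mul, Complex.norm_exp_ofReal_mul_I]

lemma clog_taylor {z : ℂ} (hz : ‖z‖ ≤ 1 / 2) : ‖Complex.log (1 + z) - (z - z ^ 2 / 2)‖ ≤ ‖z‖ ^ 3 := by
  have h := Complex.norm_log_sub_logTaylor_le 2 (z := z) (by linarith)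
  have e : Complex.logTaylor (2 + 1) z = z - z ^ 2 / 2 := by
    simp [Complex.logTaylor, Finset.sum_range_succ]; ring
  rw [e] at h
  refine h.trans ?_
  have h1 : (1 - ‖z‖)⁻¹ ≤ 2 := by
    rw [inv_le_comm₀ (by linarith) (by norm_num)]; linarith
  have h3 : 0 ≤ ‖z‖ ^ 3 := by positivity
  norm_num
  nlinarith

noncomputable def dst (s : ℂ) (x : ℝ) : ℂ :=
  Complex.log (1 + s / x) - (s * Real.log (1 + 1 / x) + s * (s - 1) / 2 * (1 / (x + 1) - 1 / x))

lemma dst_bound {T : ℝ} {s : ℂ} (hs : ‖s‖ ≤ T) {x : ℝ} (hx : 2 * (T + 1) ≤ x) :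
    ‖dst s x‖ ≤ (T ^ 3 + T + T * (T + 1)) / x ^ 3 := by
  have hT : 0 ≤ T := (norm_nonneg _).trans hs
  have hx0 : 0 < x := by linarith
  have hxc : (x : ℂ) ≠ 0 := by exact_mod_cast hx0.ne'
  have hxc1 : (x : ℂ) + 1 ≠ 0 := by exact_mod_cast (by linarith : x + 1 ≠ 0)
  have n1 : ‖s / x‖ ≤ T / x := by
    rw [norm_div, Complex.norm_real, Real.norm_of_nonneg hx0.le]; gcongr
  have n2 : ‖(1 / x : ℂ)‖ = 1 / x := by
    rw [norm_div, Complex.norm_real, Real.norm_of_nonneg hx0.le]; simp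
  have b1 : T / x ≤ 1 / 2 := by rw [div_le_div_iff₀ hx0 (by norm_num)]; linarith
  have b2 : 1 / x ≤ 1 / 2 := by rw [div_le_div_iff₀ hx0 (by norm_num)]; linarith
  have t1 := clog_taylor (n1.trans b1)
  have t2 := clog_taylor (n2.le.trans b2)
  have e : dst s x = (Complex.log (1 + s / x) - (s / x - (s / x) ^ 2 / 2))
      - s * (Complex.log (1 + 1 / x) - (1 / x - (1 / x) ^ 2 / 2))
      - s * (s - 1) / 2 * (1 / (x ^ 2 * (x + 1)) : ℝ) := by
    rw [dst, Complex.ofReal_log (by positivity)]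
    push_cast
    field_simp
    ring
  have n3 : ‖((1 / (x ^ 2 * (x + 1)) : ℝ) : ℂ)‖ ≤ 1 / x ^ 3 := by
    rw [Complex.norm_real, Real.norm_of_nonneg (by positivity)]
    apply one_div_le_one_div_of_le (by positivity)
    nlinarith [sq_nonneg x]
  have n4 : ‖s * (s - 1) / 2‖ ≤ T * (T + 1) := by
    rw [norm_div, norm_mul]
    have : ‖s - 1‖ ≤ T + 1 := (norm_sub_le _ _).trans (by simpa using hs)
    have h3 : ‖s‖ * ‖s - 1‖ ≤ T * (T + 1) := by gcongr
    have : ‖(2:ℂ)‖ = 2 := by simp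
    rw [this]
    nlinarith [mul_nonneg (norm_nonneg s) (norm_nonneg (s - 1))]
  rw [e]
  calc _ ≤ ‖s / x‖ ^ 3 + T * ‖(1 / x : ℂ)‖ ^ 3 + T * (T + 1) * (1 / x ^ 3) := by
        refine (norm_sub_le _ _).trans (add_le_add ((norm_sub_le _ _).trans (add_le_add t1 ?_)) ?_)
        · rw [norm_mul]; gcongr
        · rw [norm_mul]; gcongr
    _ ≤ (T / x) ^ 3 + T * (1 / x) ^ 3 + T * (T + 1) * (1 / x ^ 3) := by rw [n2]; gcongr
    _ = _ := by ring

lemma gammaSeq_norm (z : ℂ) (hz : 0 < z.re) :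
    Tendsto (fun n : ℕ => (n : ℂ) ^ z * (n.factorial : ℂ) / Complex.Gamma (z + (n + 1 : ℕ))) atTop (𝓝 1) := by
  have hg := Complex.Gamma_ne_zero_of_re_pos hz
  have h := (Complex.GammaSeq_tendsto_Gamma z).div_const (Complex.Gamma z)
  rw [div_self hg] at h
  refine h.congr fun n => ?_
  have hne : ∀ k : ℕ, z ≠ -k := by
    intro k hk
    rw [hk] at hz
    simp at hz
    have := Nat.cast_nonneg (α := ℝ) k
    linarith
  have h2 := Complex.Gamma_add_nat_div_Gamma_eq (n := n + 1) z hne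
  rw [div_eq_iff hg] at h2
  have h3 : ∀ N : ℕ, Polynomial.eval z (ascPochhammer ℂ N) = ∏ j ∈ Finset.range N, (z + j) := by
    intro N
    induction N with
    | zero => simp
    | succ N ih => rw [ascPochhammer_succ_eval, ih, Finset.prod_range_succ]
  rw [h2, Complex.GammaSeq, div_div, h3]

lemma gamma_ratio_tendsto {x : ℝ} (hx : 0 < x) {s : ℂ} (hs : s.re = 0) :
    Tendsto (fun N : ℕ => Complex.Gamma ((x + N : ℝ) + s) / Complex.Gamma ((x + N : ℝ)) *
      Complex.exp (-s * Real.log (x + N))) atTop (𝓝 1) := by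
  rw [← tendsto_add_atTop_iff_nat 1]
  have h1 := gammaSeq_norm (x : ℂ) (by simpa using hx)
  have h2 := gammaSeq_norm (x + s : ℂ) (by simp [hs, hx])
  have h3 := h1.div h2 one_ne_zero
  have h4 : Tendsto (fun N : ℕ => Complex.exp (-s * (Real.log (x + (N + 1 : ℕ)) - Real.log N : ℝ)))
      atTop (𝓝 1) := by
    have : Tendsto (fun N : ℕ => Real.log (x + (N + 1 : ℕ)) - Real.log N) atTop (𝓝 0) := by
      have h5 : Tendsto (fun N : ℕ => Real.log (1 + (x + 1) / N)) atTop (𝓝 0) := by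
        have : Tendsto (fun N : ℕ => 1 + (x + 1) / (N : ℝ)) atTop (𝓝 (1 + 0)) :=
          tendsto_const_nhds.add (tendsto_const_div_atTop_nhds_zero_nat _)
        rw [add_zero] at this
        simpa using this.log one_ne_zero
      refine h5.congr' ?_
      filter_upwards [eventually_gt_atTop 0] with N hN
      have hN' : (0:ℝ) < N := by exact_mod_cast hN
      rw [← Real.log_div (by positivity) hN'.ne']
      congr 1
      push_cast
      field_simp
      ring
    have h6 := (Complex.continuous_exp.tendsto _).comp
      (((Complex.continuous_ofReal.tendsto _).comp this).const_mul (-s))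
    simpa [Function.comp_def] using h6
  have h7 := h3.mul h4
  rw [div_one, one_mul] at h7
  refine h7.congr' ?_
  filter_upwards [eventually_gt_atTop 0] with N hN
  have hN' : (N : ℂ) ≠ 0 := by exact_mod_cast hN.ne'
  have hf : (N.factorial : ℂ) ≠ 0 := by exact_mod_cast N.factorial_ne_zero
  have g1 : Complex.Gamma ((x : ℂ) + (N + 1 : ℕ)) ≠ 0 := by
    apply Complex.Gamma_ne_zero_of_re_pos
    simp
    positivity
  have g2 : Complex.Gamma ((x : ℂ) + s + (N + 1 : ℕ)) ≠ 0 := by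
    apply Complex.Gamma_ne_zero_of_re_pos
    simp [hs]
    positivity
  have e1 : (N : ℂ) ^ (x + s : ℂ) = (N : ℂ) ^ (x : ℂ) * Complex.exp (s * Real.log N) := by
    rw [Complex.cpow_add _ _ hN', Complex.cpow_def_of_ne_zero hN' s, Complex.natCast_log]
    ring_nf
  have e2 : Complex.exp (-s * (Real.log (x + (N + 1 : ℕ)) - Real.log N : ℝ)) =
      Complex.exp (-s * Real.log (x + (N + 1 : ℕ))) * Complex.exp (s * Real.log N) := by
    rw [← Complex.exp_add]; congr 1; push_cast; ring
  have e3 : (N : ℂ) ^ (x : ℂ) ≠ 0 := by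
    rw [Complex.cpow_def_of_ne_zero hN']; exact Complex.exp_ne_zero _
  have e4 := Complex.exp_ne_zero (s * Real.log N)
  rw [Pi.div_apply, e1, e2, show (((x + (N + 1 : ℕ) : ℝ) : ℂ) + s) = (x : ℂ) + s + (N + 1 : ℕ) by push_cast; ring,
    show (((x + (N + 1 : ℕ) : ℝ) : ℂ)) = (x : ℂ) + (N + 1 : ℕ) by push_cast; ring]
  field_simp

noncomputable def Ff (s : ℂ) (x : ℝ) : ℂ :=
  Complex.Gamma (x + s) / Complex.Gamma x * Complex.exp (-s * Real.log x - s * (s - 1) / 2 * (1 / x))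

lemma Ff_succ {s : ℂ} (hs : s.re = 0) {x : ℝ} (hx : 0 < x) :
    Ff s (x + 1) = Ff s x * Complex.exp (dst s x) := by
  have hxc : (x : ℂ) ≠ 0 := by exact_mod_cast hx.ne'
  have hxs : (x : ℂ) + s ≠ 0 := by
    intro h
    have := congrArg Complex.re h
    simp [hs] at this
    linarith
  have g1 : Complex.Gamma (x : ℂ) ≠ 0 := Complex.Gamma_ne_zero_of_re_pos (by simpa using hx)
  have e1 : Complex.Gamma ((x + 1 : ℝ) + s) = (x + s) * Complex.Gamma (x + s) := by
    rw [← Complex.Gamma_add_one _ hxs]; congr 1; push_cast; ring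
  have e2 : Complex.Gamma ((x + 1 : ℝ)) = x * Complex.Gamma x := by
    rw [← Complex.Gamma_add_one _ hxc]; push_cast; rfl
  have e3 : Complex.exp (Complex.log (1 + s / x)) = (x + s) / x := by
    rw [Complex.exp_log]
    · field_simp
    · rw [show 1 + s / x = (x + s) / x by field_simp]
      exact div_ne_zero hxs hxc
  have e4 : Real.log (x + 1) = Real.log x + Real.log (1 + 1 / x) := by
    rw [← Real.log_mul hx.ne' (by positivity)]; congr 1; field_simp
  rw [Ff, Ff, e1, e2, e4, dst, mul_assoc, ← Complex.exp_add]
  rw [show (-s * Real.log x - s * (s - 1) / 2 * (1 / x) + (Complex.log (1 + s / x) -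
      (s * Real.log (1 + 1 / x) + s * (s - 1) / 2 * (1 / (x + 1) - 1 / x))) : ℂ) =
      (-s * (Real.log x + Real.log (1 + 1 / x) : ℝ) - s * (s - 1) / 2 * (1 / (x + 1 : ℝ)))
      + Complex.log (1 + s / x) by push_cast; ring, Complex.exp_add _ (Complex.log _), e3]
  field_simp

lemma inv_cube_le {y : ℝ} (hy : 1 < y) : 1 / y ^ 3 ≤ 1 / (y - 1) ^ 2 - 1 / y ^ 2 := by
  have h1 : 0 < y - 1 := by linarith
  rw [div_sub_div _ _ (by positivity) (by positivity), div_le_div_iff₀ (by positivity) (by positivity)]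
  have : 0 ≤ y ^ 2 * (y - 1) := by positivity
  have h5 : (1 * y ^ 2 - (y - 1) ^ 2 * 1) * y ^ 3 - 1 * ((y - 1) ^ 2 * y ^ 2) = y ^ 2 * (y ^ 2 - 1 + y) := by ring
  have h6 : 0 ≤ y ^ 2 * (y ^ 2 - 1 + y) := by
    have : 0 ≤ y ^ 2 - 1 := by nlinarith
    positivity
  linarith

lemma Ff_exp {T : ℝ} {s : ℂ} (hs0 : s.re = 0) (hs : ‖s‖ ≤ T) {x : ℝ} (hx : 2 * (T + 1) ≤ x) :
    ∃ δ : ℂ, ‖δ‖ ≤ 4 * (T ^ 3 + T + T * (T + 1)) / x ^ 2 ∧ Ff s x = Complex.exp δ := by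
  have hT : 0 ≤ T := (norm_nonneg _).trans hs
  set K := T ^ 3 + T + T * (T + 1) with hK
  have hK0 : 0 ≤ K := by positivity
  have hx0 : 0 < x := by linarith
  have hb : ∀ k : ℕ, ‖dst s (x + k)‖ ≤ K * (1 / (x + k) ^ 3) := by
    intro k
    have : (0:ℝ) ≤ k := Nat.cast_nonneg k
    refine (dst_bound hs (by linarith)).trans (le_of_eq ?_)
    ring
  have hsum : ∀ N : ℕ, ∑ k ∈ Finset.range N, 1 / (x + k) ^ 3 ≤ 1 / (x - 1) ^ 2 - 1 / (x + N - 1) ^ 2 := by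
    intro N
    induction N with
    | zero => simp
    | succ N ih =>
      rw [Finset.sum_range_succ]
      have : (0:ℝ) ≤ N := Nat.cast_nonneg N
      have := inv_cube_le (y := x + N) (by linarith)
      push_cast
      rw [show x + (N + 1) - 1 = x + N by ring]
      linarith
  have hsum2 : ∀ N : ℕ, ∑ k ∈ Finset.range N, 1 / (x + k) ^ 3 ≤ 4 / x ^ 2 := by
    intro N
    refine (hsum N).trans ?_
    have h1 : 0 ≤ 1 / (x + N - 1) ^ 2 := by positivity
    have h2 : 1 / (x - 1) ^ 2 ≤ 4 / x ^ 2 := by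
      rw [div_le_div_iff₀ (by nlinarith) (by positivity)]
      nlinarith
    linarith
  have hs1 : Summable fun k : ℕ => 1 / (x + k) ^ 3 :=
    summable_of_sum_range_le (fun k => by positivity) hsum2
  have hs2 : Summable fun k : ℕ => dst s (x + k) :=
    Summable.of_norm_bounded (hs1.mul_left K) hb
  have hts : ‖∑' k : ℕ, dst s (x + k)‖ ≤ 4 * K / x ^ 2 := by
    refine (tsum_of_norm_bounded (hs1.mul_left K).hasSum hb).trans ?_
    rw [tsum_mul_left]
    have : ∑' k : ℕ, 1 / (x + k) ^ 3 ≤ 4 / x ^ 2 :=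
      Real.tsum_le_of_sum_range_le (fun k => by positivity) hsum2
    calc _ ≤ K * (4 / x ^ 2) := by gcongr
      _ = _ := by ring
  have hFN : ∀ N : ℕ, Ff s (x + N) = Ff s x * Complex.exp (∑ k ∈ Finset.range N, dst s (x + k)) := by
    intro N
    induction N with
    | zero => simp
    | succ N ih =>
      have h0 : 0 < x + N := by positivity
      rw [Finset.sum_range_succ, Complex.exp_add, ← mul_assoc, ← ih, ← Ff_succ hs0 h0]
      push_cast; rw [add_assoc]
  have hlim1 : Tendsto (fun N : ℕ => Ff s (x + N)) atTop (𝓝 1) := by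
    have h1 := gamma_ratio_tendsto hx0 hs0
    have h2 : Tendsto (fun N : ℕ => Complex.exp (-(s * (s - 1) / 2) * (1 / (x + N) : ℝ))) atTop (𝓝 1) := by
      have h3 : Tendsto (fun N : ℕ => 1 / (x + N)) atTop (𝓝 0) :=
        Tendsto.const_div_atTop (tendsto_atTop_add_const_left _ _ tendsto_natCast_atTop_atTop) _
      have h6 := (Complex.continuous_exp.tendsto _).comp
        (((Complex.continuous_ofReal.tendsto _).comp h3).const_mul (-(s * (s - 1) / 2)))
      simpa [Function.comp_def] using h6
    have h3 := h1.mul h2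
    rw [one_mul] at h3
    refine h3.congr fun N => ?_
    rw [Ff, mul_assoc, ← Complex.exp_add]
    congr 2
    push_cast; ring
  have hlim2 : Tendsto (fun N : ℕ => Ff s (x + N)) atTop
      (𝓝 (Ff s x * Complex.exp (∑' k : ℕ, dst s (x + k)))) := by
    simp_rw [hFN]
    exact ((Complex.continuous_exp.tendsto _).comp hs2.hasSum.tendsto_sum_nat).const_mul _
  have := tendsto_nhds_unique hlim2 hlim1
  refine ⟨-∑' k : ℕ, dst s (x + k), by rwa [norm_neg], ?_⟩
  rw [Complex.exp_neg]
  exact eq_inv_of_mul_eq_one_left this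

/-- Main asymptotics of the characteristic function of `log χ²_m`. -/
lemma chi_asymp {T : ℝ} (τ : ℝ) (hτ : |τ| ≤ T) (m : ℕ) (hm : 4 * (T + 1) ≤ m) :
    ∃ δ : ℂ, ‖δ‖ ≤ 16 * (T ^ 3 + T + T * (T + 1)) / m ^ 2 ∧
      chi m τ = Complex.exp (τ * Real.log m * Complex.I + (-τ ^ 2 - τ * Complex.I) * (1 / m : ℝ) + δ) := by
  have hT : 0 ≤ T := (abs_nonneg _).trans hτ
  have hm0 : (0:ℝ) < m := by linarith
  obtain ⟨δ, h1, h2⟩ := Ff_exp (s := τ * Complex.I) (T := T) (by simp) (by simpa using hτ)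
    (x := m / 2) (by linarith)
  refine ⟨δ, h1.trans (le_of_eq (by field_simp; ring)), ?_⟩
  rw [Ff] at h2
  have h3 : Complex.Gamma ((m / 2 : ℝ) + τ * Complex.I) / Complex.Gamma ((m / 2 : ℝ)) =
      Complex.exp (δ + (τ * Complex.I * Real.log (m / 2) +
        (τ * Complex.I) * (τ * Complex.I - 1) / 2 * (1 / (m / 2 : ℝ)))) := by
    rw [Complex.exp_add, ← h2, mul_assoc, ← Complex.exp_add]
    ring_nf
    simp
  rw [chi, mul_div_assoc, ← Complex.ofReal_natCast m]
  rw [show ((m : ℝ) : ℂ) / 2 = ((m / 2 : ℝ) : ℂ) by push_cast; rfl, h3, ← Complex.exp_add]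
  congr 1
  rw [Real.log_div hm0.ne' (by norm_num)]
  have hmc : (m : ℂ) ≠ 0 := by exact_mod_cast hm0.ne'
  push_cast
  field_simp
  linear_combination ((τ:ℂ) ^ 2) * Complex.I_sq

noncomputable def Vn (n p : ℕ) : ℝ := 2 * ∑ j ∈ Finset.range p, (1 / ((n - j : ℕ) : ℝ) - 1 / (n : ℝ))

noncomputable def Ln (n p : ℕ) : ℝ :=
  ∑ j ∈ Finset.range p, (Real.log ((n - j : ℕ) : ℝ) - Real.log (n : ℝ))

lemma prod_chi {T κ : ℝ} (hκ : 0 < κ) (τ : ℝ) (hτ : |τ| ≤ T) (n p : ℕ) (hp : p ≤ n)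
    (h1 : κ * n ≤ (n : ℝ) - p) (h2 : 4 * (T + 1) ≤ κ * n) :
    ∃ δ : ℂ, ‖δ‖ ≤ (32 * (T ^ 3 + T + T * (T + 1)) / κ ^ 2) / n ∧
      ∏ j ∈ Finset.range p, chi (n - j) τ / chi n τ =
        Complex.exp (τ * Ln n p * Complex.I + (-τ ^ 2 - τ * Complex.I) * (Vn n p / 2 : ℝ) + δ) := by
  have hT : 0 ≤ T := (abs_nonneg _).trans hτ
  set K := T ^ 3 + T + T * (T + 1) with hK
  have hK0 : 0 ≤ K := by positivity
  have hn0 : (0:ℝ) < n := by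
    rcases Nat.eq_zero_or_pos n with h | h
    · subst h; simp at h2; linarith
    · exact_mod_cast h
  have hpn : (p:ℝ) ≤ n := by exact_mod_cast hp
  have hp0 : (0:ℝ) ≤ p := Nat.cast_nonneg p
  have hκn : 0 < κ * n := by positivity
  have key : ∀ m : ℕ, κ * n ≤ m → ∃ δ : ℂ, ‖δ‖ ≤ 16 * K / (κ * n) ^ 2 ∧
      chi m τ = Complex.exp (τ * Real.log m * Complex.I + (-τ ^ 2 - τ * Complex.I) * (1 / m : ℝ) + δ) := by
    intro m hm
    obtain ⟨δ, a, b⟩ := chi_asymp τ hτ m (h2.trans hm)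
    refine ⟨δ, a.trans ?_, b⟩
    gcongr
  have key2 : ∀ j ∈ Finset.range p, κ * n ≤ ((n - j : ℕ) : ℝ) := by
    intro j hj
    have hj := Finset.mem_range.1 hj
    rw [Nat.cast_sub (by omega)]
    have : (j:ℝ) ≤ p := by exact_mod_cast hj.le
    linarith
  obtain ⟨δ0, hδ0, e0⟩ := key n (by linarith)
  have key3 : ∀ j : ℕ, ∃ δ : ℂ, j ∈ Finset.range p → (‖δ‖ ≤ 16 * K / (κ * n) ^ 2 ∧
      chi (n - j) τ = Complex.exp (τ * Real.log (n - j : ℕ) * Complex.I +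
        (-τ ^ 2 - τ * Complex.I) * (1 / (n - j : ℕ) : ℝ) + δ)) := by
    intro j
    by_cases hj : j ∈ Finset.range p
    · obtain ⟨δ, h⟩ := key _ (key2 j hj)
      exact ⟨δ, fun _ => h⟩
    · exact ⟨0, fun h => absurd h hj⟩
  choose δ hδ using key3
  refine ⟨∑ j ∈ Finset.range p, (δ j - δ0), ?_, ?_⟩
  · calc _ ≤ ∑ j ∈ Finset.range p, (32 * K / (κ * n) ^ 2) := by
          refine norm_sum_le_of_le _ fun j hj => (norm_sub_le _ _).trans ?_
          have := (hδ j hj).1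
          calc _ ≤ 16 * K / (κ * n) ^ 2 + 16 * K / (κ * n) ^ 2 := add_le_add this hδ0
            _ = _ := by ring
      _ = p * (32 * K / (κ * n) ^ 2) := by simp
      _ ≤ n * (32 * K / (κ * n) ^ 2) := by gcongr
      _ = _ := by field_simp
  · have : ∀ j ∈ Finset.range p, chi (n - j) τ / chi n τ = Complex.exp (
        τ * (Real.log ((n - j : ℕ) : ℝ) - Real.log (n : ℝ) : ℝ) * Complex.I +
        (-τ ^ 2 - τ * Complex.I) * (1 / ((n - j : ℕ) : ℝ) - 1 / (n : ℝ) : ℝ) + (δ j - δ0)) := by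
      intro j hj
      rw [(hδ j hj).2, e0, ← Complex.exp_sub]
      congr 1
      push_cast
      ring
    rw [Finset.prod_congr rfl this, ← Complex.exp_sum, Finset.sum_add_distrib, Finset.sum_add_distrib,
      ← Finset.sum_mul, ← Finset.mul_sum, ← Finset.mul_sum, Ln, Vn]
    congr 2
    push_cast
    ring

lemma Vn_lower {n p : ℕ} (hp : p ≤ n) : ((p : ℝ) / n) * ((p : ℝ) / n - 1 / n) ≤ Vn n p := by
  rcases Nat.eq_zero_or_pos p with rfl | h0
  · simp [Vn]
  have hn0 : (0:ℝ) < n := by exact_mod_cast (by omega : 0 < n)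
  have h1 : ∀ j ∈ Finset.range p, (j : ℝ) / n ^ 2 ≤ 1 / ((n - j : ℕ) : ℝ) - 1 / (n : ℝ) := by
    intro j hj
    have hj := Finset.mem_range.1 hj
    have hm : (0:ℝ) < (n:ℝ) - j := by
      have : (j:ℝ) < n := by exact_mod_cast (by omega : j < n)
      linarith
    have hj0 : (0:ℝ) ≤ j := Nat.cast_nonneg j
    rw [Nat.cast_sub (by omega), div_sub_div _ _ hm.ne' hn0.ne', div_le_div_iff₀ (by positivity) (by positivity)]
    have : 0 ≤ (j:ℝ) * n * j := by positivity
    nlinarith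
  have h2 := Finset.sum_le_sum h1
  rw [← Finset.sum_div] at h2
  have h3 : (∑ j ∈ Finset.range p, (j : ℝ)) * 2 = p * (p - 1) := by
    have := Finset.sum_range_id_mul_two p
    have h4 : ((∑ j ∈ Finset.range p, j : ℕ) : ℝ) * 2 = p * ((p - 1 : ℕ) : ℝ) := by exact_mod_cast this
    rw [Nat.cast_sub h0] at h4
    simpa using h4
  rw [Vn]
  calc _ = (p * (p - 1) : ℝ) / n ^ 2 := by field_simp
    _ = 2 * ((∑ j ∈ Finset.range p, (j : ℝ)) / n ^ 2) := by rw [← h3]; ring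
    _ ≤ _ := by gcongr

lemma log_ratio_bound {a b e : ℝ} (hb : 0 < b) (h : |a - b| ≤ e) (he : e ≤ b / 2) :
    |Real.log a - Real.log b| ≤ 2 * e / b := by
  have h' := abs_le.1 h
  have he0 : 0 ≤ e := (abs_nonneg _).trans h
  have ha : b / 2 ≤ a := by linarith
  have ha0 : 0 < a := by linarith
  rw [← Real.log_div ha0.ne' hb.ne', abs_le]
  have u := Real.log_le_sub_one_of_pos (x := a / b) (by positivity)
  have l := Real.one_sub_inv_le_log_of_pos (x := a / b) (by positivity)
  constructor
  · refine le_trans ?_ l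
    rw [inv_div, neg_le, show -(1 - b / a) = (b - a) / a by field_simp; ring, div_le_div_iff₀ ha0 hb]
    nlinarith
  · refine u.trans ?_
    rw [show a / b - 1 = (a - b) / b by field_simp]
    gcongr
    linarith

lemma quot_bound {a q c m C e : ℝ} (hC : 1 ≤ C) (hm : 0 < m) (hc : C⁻¹ ≤ c) (hc2 : c ≤ C)
    (ha : |a - c * m| ≤ e) (hq : |q - c ^ 2 * m| ≤ e) (he : e ≤ C⁻¹ * m / 2) :
    |q / a ^ 2 - 1 / m| ≤ 16 * C ^ 3 * e / m ^ 2 := by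
  have hCi : 0 < C⁻¹ := by positivity
  have hc0 : 0 < c := by linarith
  have he0 : 0 ≤ e := (abs_nonneg _).trans ha
  have ha' := abs_le.1 ha
  have hcm : C⁻¹ * m ≤ c * m := by gcongr
  have ha1 : C⁻¹ * m / 2 ≤ a := by linarith
  have hCm : 0 < C⁻¹ * m := by positivity
  have ha0 : 0 < a := by linarith
  have e1 : q / a ^ 2 - 1 / m = ((q - c ^ 2 * m) * m - (a - c * m) * (a + c * m)) / (a ^ 2 * m) := by
    field_simp; ring
  have hnum : |(q - c ^ 2 * m) * m - (a - c * m) * (a + c * m)| ≤ e * (4 * C * m) := by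
    refine (abs_sub _ _).trans ?_
    rw [abs_mul, abs_mul, abs_of_pos hm, abs_of_pos (show 0 < a + c * m by positivity)]
    have : a + c * m ≤ 3 * C * m := by
      have : c * m ≤ C * m := by gcongr
      have : C⁻¹ * m ≤ C * m := by gcongr; linarith
      linarith
    calc _ ≤ e * m + e * (3 * C * m) := by gcongr
      _ ≤ _ := by nlinarith [mul_nonneg he0 hm.le]
  have hden : C⁻¹ ^ 2 * m ^ 3 / 4 ≤ a ^ 2 * m := by
    have : (C⁻¹ * m / 2) ^ 2 ≤ a ^ 2 := by gcongr
    calc _ = (C⁻¹ * m / 2) ^ 2 * m := by ring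
      _ ≤ _ := by gcongr
  rw [e1, abs_div, abs_of_pos (show 0 < a ^ 2 * m by positivity)]
  calc _ ≤ e * (4 * C * m) / (C⁻¹ ^ 2 * m ^ 3 / 4) := by gcongr
    _ = _ := by field_simp; norm_num

lemma det_bounds {n p : ℕ} {C κ c : ℝ} {lam : Fin n → ℝ} (hC : 1 ≤ C) (hκ : 0 < κ) (hp : 1 ≤ p) (hpn : p ≤ n)
    (h1 : κ * n ≤ (n : ℝ) - p) (hl : ∀ k, C⁻¹ ≤ lam k) (hc : C⁻¹ ≤ c) (hc2 : c ≤ C)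
    (hsum : ∑ k, (lam k - c) = 0)
    (hsm : (2 * C * (C ^ 3 + C) + 1) * ∑ k, (lam k - c) ^ 2 ≤ C⁻¹ * (κ * n) / 2) :
    |sigmaSq n p lam - Vn n p| ≤
      (32 * C ^ 3 * (2 * C * (C ^ 3 + C) + 1) / κ ^ 2 * (∑ k, (lam k - c) ^ 2) + 2) / n ∧
    |∑ i ∈ Finset.Ico 1 p, (Real.log (∑ k, lam k * tval i lam k) - Real.log c - Real.log ((n - i : ℕ) : ℝ))| ≤
      2 * C * (2 * C * (C ^ 3 + C) + 1) / κ * (∑ k, (lam k - c) ^ 2) := by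
  set M := 2 * C * (C ^ 3 + C) + 1 with hM
  set S := ∑ k, (lam k - c) ^ 2 with hS
  have hS0 : 0 ≤ S := Finset.sum_nonneg fun k _ => sq_nonneg _
  have hC0 : 0 < C := by linarith
  have hCi : 0 < C⁻¹ := by positivity
  have hc0 : 0 < c := by linarith
  have hM0 : 0 < M := by positivity
  have hn0 : (0:ℝ) < n := by exact_mod_cast (by omega : 0 < n)
  have hMle : C ^ 3 + C ≤ M := by
    have : 0 < C ^ 3 + C := by positivity
    nlinarith
  have hpn' : (p:ℝ) ≤ n := by exact_mod_cast hpn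
  have hmi : ∀ i ∈ Finset.Ico 1 p, ((n - i : ℕ) : ℝ) = (n : ℝ) - i ∧ κ * n ≤ (n : ℝ) - i ∧ i < n := by
    intro i hi
    have hi := Finset.mem_Ico.1 hi
    have : (i:ℝ) ≤ p := by exact_mod_cast hi.2.le
    exact ⟨Nat.cast_sub (by omega), by linarith, by omega⟩
  have hlin : ∀ i ∈ Finset.Ico 1 p, |∑ k, lam k * tval i lam k - c * ((n - i : ℕ) : ℝ)| ≤ M * S := by
    intro i hi
    obtain ⟨a, _, b⟩ := hmi i hi
    rw [a]
    refine (tval_lin b hC0 hl hc hc2 hsum).trans ?_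
    gcongr
  have hquad : ∀ i ∈ Finset.Ico 1 p, |∑ k, lam k ^ 2 * tval i lam k - c ^ 2 * ((n - i : ℕ) : ℝ)| ≤ M * S := by
    intro i hi
    obtain ⟨a, _, b⟩ := hmi i hi
    rw [a]
    exact tval_quad b hC0 hl hc hc2 hsum
  have hκn : 0 < κ * n := by positivity
  have hm0 : ∀ i ∈ Finset.Ico 1 p, κ * n ≤ ((n - i : ℕ) : ℝ) := by
    intro i hi; obtain ⟨a, b, _⟩ := hmi i hi; rw [a]; exact b
  have hsmi : ∀ i ∈ Finset.Ico 1 p, M * S ≤ C⁻¹ * ((n - i : ℕ) : ℝ) / 2 := by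
    intro i hi
    refine hsm.trans ?_
    have := hm0 i hi
    gcongr
  have hcard : ((Finset.Ico 1 p).card : ℝ) ≤ n := by
    rw [Nat.card_Ico]; exact_mod_cast (by omega : p - 1 ≤ n)
  have hrange : ∀ f : ℕ → ℝ, ∑ j ∈ Finset.range p, f j = f 0 + ∑ j ∈ Finset.Ico 1 p, f j := by
    intro f
    rw [Finset.range_eq_Ico, Finset.sum_eq_sum_Ico_succ_bot (by omega)]
  constructor
  · have e : sigmaSq n p lam - Vn n p = 2 * ∑ i ∈ Finset.Ico 1 p,
        ((∑ k, lam k ^ 2 * tval i lam k) / (∑ k, lam k * tval i lam k) ^ 2 - 1 / ((n - i : ℕ) : ℝ)) - 2 / n := by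
      rw [sigmaSq, Vn, Finset.sum_sub_distrib, Finset.sum_sub_distrib, hrange]
      simp
      ring
    have hb : |∑ i ∈ Finset.Ico 1 p,
        ((∑ k, lam k ^ 2 * tval i lam k) / (∑ k, lam k * tval i lam k) ^ 2 - 1 / ((n - i : ℕ) : ℝ))| ≤
        n * (16 * C ^ 3 * (M * S) / (κ * n) ^ 2) := by
      refine (Finset.abs_sum_le_sum_abs _ _).trans ?_
      calc _ ≤ ∑ i ∈ Finset.Ico 1 p, (16 * C ^ 3 * (M * S) / (κ * n) ^ 2) := by
            refine Finset.sum_le_sum fun i hi => ?_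
            have h := hm0 i hi
            refine (quot_bound hC (hκn.trans_le h) hc hc2 (hlin i hi) (hquad i hi) (hsmi i hi)).trans ?_
            gcongr
        _ = (Finset.Ico 1 p).card * (16 * C ^ 3 * (M * S) / (κ * n) ^ 2) := by simp
        _ ≤ _ := by gcongr
    rw [e]
    calc _ ≤ 2 * (n * (16 * C ^ 3 * (M * S) / (κ * n) ^ 2)) + 2 / n := by
          refine (abs_sub _ _).trans (add_le_add ?_ ?_)
          · rw [abs_mul, abs_two]; gcongr
          · rw [abs_of_pos (by positivity)]
      _ = _ := by field_simp; ring
  · refine (Finset.abs_sum_le_sum_abs _ _).trans ?_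
    calc _ ≤ ∑ i ∈ Finset.Ico 1 p, (2 * (M * S) / (C⁻¹ * (κ * n))) := by
          refine Finset.sum_le_sum fun i hi => ?_
          have h := hm0 i hi
          have hmp := hκn.trans_le h
          have h5 : C⁻¹ * ((n - i : ℕ) : ℝ) ≤ c * ((n - i : ℕ) : ℝ) := by gcongr
          have h6 : C⁻¹ * (κ * n) ≤ c * ((n - i : ℕ) : ℝ) := by gcongr
          rw [sub_sub, ← Real.log_mul hc0.ne' hmp.ne']
          refine (log_ratio_bound (by positivity) (hlin i hi) ((hsmi i hi).trans (by linarith))).trans ?_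
          gcongr
      _ = (Finset.Ico 1 p).card * (2 * (M * S) / (C⁻¹ * (κ * n))) := by simp
      _ ≤ n * (2 * (M * S) / (C⁻¹ * (κ * n))) := by gcongr
      _ = _ := by field_simp

lemma mu_eq {n p : ℕ} (A : Matrix (Fin n) (Fin n) ℝ) (lam : Fin n → ℝ) {c : ℝ} (hc0 : 0 < c) (hn : 1 ≤ n)
    (hp : 1 ≤ p) (ht : trace (A * Aᵀ) = c * n) :
    muSeq n p A lam = p * Real.log c + Ln n p - Vn n p / 2 + (Vn n p - sigmaSq n p lam) / 2 +
      ∑ i ∈ Finset.Ico 1 p, (Real.log (∑ k, lam k * tval i lam k) - Real.log c - Real.log ((n - i : ℕ) : ℝ)) := by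
  have hn0 : (0:ℝ) < n := by exact_mod_cast hn
  have hrange : ∀ f : ℕ → ℝ, ∑ j ∈ Finset.range p, f j = f 0 + ∑ j ∈ Finset.Ico 1 p, f j := by
    intro f
    rw [Finset.range_eq_Ico, Finset.sum_eq_sum_Ico_succ_bot (by omega)]
  rw [muSeq, ht, Real.log_mul hc0.ne' hn0.ne', Ln, hrange]
  simp only [Finset.sum_sub_distrib, Finset.sum_const, Nat.card_Ico, nsmul_eq_mul]
  rw [Nat.cast_sub hp]
  simp
  ring

lemma eig_facts {n : ℕ} {M : Matrix (Fin n) (Fin n) ℝ} {lam : Fin n → ℝ} (h : IsOrderedEigenvalues M lam) (c : ℝ) :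
    trace M = ∑ k, lam k ∧ trace ((M - c • (1 : Matrix (Fin n) (Fin n) ℝ)) ^ 2) = ∑ k, (lam k - c) ^ 2 := by
  obtain ⟨_, hM, σ, rfl⟩ := h
  obtain ⟨W, hW, hD⟩ := spectral_real hM
  have hWW : W * Wᵀ = 1 := mul_eq_one_comm.1 hW
  have hMe : M = W * diagonal hM.eigenvalues * Wᵀ := by
    rw [← hD]
    calc M = (W * Wᵀ) * M * (W * Wᵀ) := by rw [hWW]; simp
      _ = _ := by simp only [Matrix.mul_assoc]
  have hconj : ∀ X : Matrix (Fin n) (Fin n) ℝ, trace (W * X * Wᵀ) = trace X := by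
    intro X
    rw [Matrix.trace_mul_comm, ← Matrix.mul_assoc, hW, Matrix.one_mul]
  constructor
  · rw [Function.comp_def, Equiv.sum_comp σ (fun k => hM.eigenvalues k)]
    conv_lhs => rw [hMe, hconj, Matrix.trace_diagonal]
  · have e1 : M - c • (1 : Matrix (Fin n) (Fin n) ℝ) = W * diagonal (fun k => hM.eigenvalues k - c) * Wᵀ := by
      have : diagonal (fun k => hM.eigenvalues k - c) = diagonal hM.eigenvalues - c • (1 : Matrix (Fin n) (Fin n) ℝ) := by
        rw [Matrix.smul_one_eq_diagonal, Matrix.diagonal_sub]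
      rw [this, Matrix.mul_sub, Matrix.sub_mul, ← hMe]
      simp [hWW]
    have e2 : (M - c • (1 : Matrix (Fin n) (Fin n) ℝ)) ^ 2 = W * diagonal (fun k => (hM.eigenvalues k - c) ^ 2) * Wᵀ := by
      rw [e1, pow_two]
      calc _ = W * diagonal (fun k => hM.eigenvalues k - c) * (Wᵀ * W) * diagonal (fun k => hM.eigenvalues k - c) * Wᵀ := by
            simp only [Matrix.mul_assoc]
        _ = _ := by
            rw [hW, Matrix.mul_one, Matrix.mul_assoc W, Matrix.diagonal_mul_diagonal]
            simp only [pow_two]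
    rw [e2, hconj, Matrix.trace_diagonal]
    exact (Equiv.sum_comp σ (fun k => (hM.eigenvalues k - c) ^ 2)).symm

lemma exp_I_sub_le (a b : ℝ) : ‖Complex.exp (a * Complex.I) - Complex.exp (b * Complex.I)‖ ≤ |a - b| := by
  have e : Complex.exp (a * Complex.I) - Complex.exp (b * Complex.I) =
      Complex.exp (b * Complex.I) * (Complex.exp (Complex.I * (a - b : ℝ)) - 1) := by
    rw [mul_sub, ← Complex.exp_add, mul_one]
    congr 2
    push_cast; ring
  rw [e, norm_mul, Complex.norm_exp_ofReal_mul_I, one_mul]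
  exact Real.norm_exp_I_mul_ofReal_sub_one_le

lemma cf_diff {n p : ℕ} (hp : p ≤ n) {C c : ℝ} (hC : 0 < C) (hc : C⁻¹ ≤ c) {lam : Fin n → ℝ}
    (hl : ∀ k, C⁻¹ ≤ lam k) (hd : ∑ k, (lam k - c) = 0) (τ m : ℝ) :
    ‖(∫ ω, Complex.exp ((τ * (ldB lam ω - m) : ℝ) * Complex.I) ∂(Measure.pi fun _ : Fin p => uniformSphere n)) -
      Complex.exp ((τ * (p * Real.log c - m) : ℝ) * Complex.I) *
        ∏ j ∈ Finset.range p, chi (n - j) τ / chi n τ‖ ≤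
      |τ| * (C ^ 2 * ∑ k, (lam k - c) ^ 2 + C * Real.sqrt (∑ k, (lam k - c) ^ 2)) := by
  obtain ⟨Z, hZ, hae, hinteg⟩ := ldB_L1 hp hC hc hl hd
  rw [← ldB_chi τ p hp, ← integral_const_mul]
  have m1 := measurable_ldB (p := p) lam
  have m2 := measurable_ldB (n := n) (p := p) (fun _ => 1)
  rw [← integral_sub]
  · refine (norm_integral_le_of_norm_le (hZ.const_mul |τ|) ?_).trans ?_
    · filter_upwards [hae] with ω hω
      rw [← Complex.exp_add]
      have := exp_I_sub_le (τ * (ldB lam ω - m)) (τ * (p * Real.log c - m) + τ * ldB (fun _ => 1) ω)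
      calc _ ≤ _ := by
            refine le_trans (le_of_eq ?_) this
            congr 3
            push_cast; ring
        _ = |τ| * |ldB lam ω - (p * Real.log c + ldB (fun _ => 1) ω)| := by
            rw [← abs_mul]; congr 1; ring
        _ ≤ _ := by gcongr
    · rw [integral_const_mul]; gcongr
  · refine Integrable.of_bound (C := 1) ?_ (Eventually.of_forall fun z => ?_)
    · apply Measurable.aestronglyMeasurable; fun_prop
    · rw [Complex.norm_exp_ofReal_mul_I]
  · refine Integrable.of_bound (C := 1) ?_ (Eventually.of_forall fun z => ?_)
    · apply Measurable.aestronglyMeasurable; fun_prop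
    · rw [norm_mul, Complex.norm_exp_ofReal_mul_I, ← Complex.ofReal_mul, Complex.norm_exp_ofReal_mul_I, one_mul]

/-- **Theorem 2.1.** Under Assumptions (A) and (B), as `n → ∞`,
`(log det(YYᵀ) − μ_n)/σ_n` converges in distribution to `N(0,1)`, where `Y` is the `p × n`
matrix with rows `A u_i` for independent uniform directions `u_1, …, u_p` on `S^{n-1}`. -/
theorem logDet_clt (p : ℕ → ℕ) (γ : ℝ)
    (A : ∀ n, Matrix (Fin n) (Fin n) ℝ) (lam : ∀ n, Fin n → ℝ)
    (hp : ∀ n, p n ≤ n)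
    (hfull : ∀ n, IsUnit (A n).det)
    (hlam : ∀ n, IsOrderedEigenvalues (A n * (A n)ᵀ) (lam n))
    (hγ : 0 < γ ∧ γ < 1)
    (hA : Filter.Tendsto (fun n => (p n : ℝ) / (n : ℝ)) Filter.atTop (𝓝 γ))
    (C : ℝ) (hC : 1 ≤ C)
    (hB1 : ∀ n k, C⁻¹ ≤ lam n k ∧ lam n k ≤ C)
    (hB2 : Filter.Tendsto
      (fun n => Matrix.trace
        ((A n * (A n)ᵀ -
          (Matrix.trace (A n * (A n)ᵀ) / (n : ℝ)) • (1 : Matrix (Fin n) (Fin n) ℝ)) ^ 2))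
      Filter.atTop (𝓝 0)) :
    ∀ f : BoundedContinuousFunction ℝ ℝ,
      Filter.Tendsto
        (fun n => ∫ ω,
          f ((logDetYY n (p n) (A n) ω - muSeq n (p n) (A n) (lam n)) /
              Real.sqrt (sigmaSq n (p n) (lam n)))
          ∂(Measure.pi fun _ : Fin (p n) => uniformSphere n))
        Filter.atTop (𝓝 (∫ x, f x ∂(gaussianReal 0 1))) := by
  have hC0 : 0 < C := by linarith
  have hCi : 0 < C⁻¹ := by positivity
  set c : ℕ → ℝ := fun n => trace (A n * (A n)ᵀ) / (n : ℝ) with hcdef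
  set S : ℕ → ℝ := fun n => ∑ k, (lam n k - c n) ^ 2 with hSdef
  have hS : Tendsto S atTop (𝓝 0) := by
    refine hB2.congr fun n => ?_
    exact (eig_facts (hlam n) (c n)).2
  have hS0 : ∀ n, 0 ≤ S n := fun n => Finset.sum_nonneg fun k _ => sq_nonneg _
  have hnat : Tendsto (fun n : ℕ => (n : ℝ)) atTop atTop := tendsto_natCast_atTop_atTop
  have htr : ∀ n, 1 ≤ n → trace (A n * (A n)ᵀ) = c n * n := by
    intro n hn
    have : (n : ℝ) ≠ 0 := by exact_mod_cast (by omega : n ≠ 0)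
    simp only [hcdef]
    field_simp
  have hsum0 : ∀ n, 1 ≤ n → ∑ k, (lam n k - c n) = 0 := by
    intro n hn
    rw [Finset.sum_sub_distrib, ← (eig_facts (hlam n) 0).1, htr n hn]
    simp
    ring
  have hcl : ∀ n, 1 ≤ n → C⁻¹ ≤ c n ∧ c n ≤ C := by
    intro n hn
    have hn0 : (0:ℝ) < n := by exact_mod_cast hn
    simp only [hcdef]
    rw [(eig_facts (hlam n) 0).1, le_div_iff₀ hn0, div_le_iff₀ hn0]
    constructor
    · have := Finset.sum_le_sum fun k (_ : k ∈ Finset.univ) => (hB1 n k).1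
      simp at this
      linarith
    · have := Finset.sum_le_sum fun k (_ : k ∈ Finset.univ) => (hB1 n k).2
      simp at this
      linarith
  set κ : ℝ := (1 - γ) / 2 with hκdef
  have hκ : 0 < κ := by rw [hκdef]; linarith [hγ.2]
  have ev1 : ∀ᶠ n : ℕ in atTop, 1 ≤ n := eventually_ge_atTop 1
  have ev2 : ∀ᶠ n : ℕ in atTop, κ * n ≤ (n : ℝ) - p n := by
    filter_upwards [ev1, hA.eventually (gt_mem_nhds (show γ < 1 - κ by rw [hκdef]; linarith [hγ.2]))]
      with n hn h
    have hn0 : (0:ℝ) < n := by exact_mod_cast hn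
    rw [div_lt_iff₀ hn0] at h
    linarith
  have ev3 : ∀ᶠ n : ℕ in atTop, 1 ≤ p n := by
    filter_upwards [hA.eventually (lt_mem_nhds hγ.1)] with n h
    by_contra h0
    have : p n = 0 := by omega
    simp [this] at h
  set M : ℝ := 2 * C * (C ^ 3 + C) + 1 with hMdef
  have ev4 : ∀ᶠ n : ℕ in atTop, M * S n ≤ C⁻¹ * (κ * n) / 2 := by
    have h1 : Tendsto (fun n => M * S n) atTop (𝓝 0) := by simpa using hS.const_mul M
    have h2 : Tendsto (fun n : ℕ => C⁻¹ * κ / 2 * (n : ℝ)) atTop atTop :=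
      hnat.const_mul_atTop (by positivity)
    filter_upwards [h1.eventually (gt_mem_nhds one_pos), h2.eventually_ge_atTop 1] with n a b
    linarith
  set V : ℕ → ℝ := fun n => Vn n (p n) with hVdef
  set s : ℕ → ℝ := fun n => sigmaSq n (p n) (lam n) with hsdef
  set R : ℕ → ℝ := fun n => ∑ i ∈ Finset.Ico 1 (p n), (Real.log (∑ k, lam n k * tval i (lam n) k) -
    Real.log (c n) - Real.log ((n - i : ℕ) : ℝ)) with hRdef
  have evB : ∀ᶠ n : ℕ in atTop, |s n - V n| ≤ (32 * C ^ 3 * M / κ ^ 2 * S n + 2) / n ∧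
      |R n| ≤ 2 * C * M / κ * S n := by
    filter_upwards [ev1, ev2, ev3, ev4] with n a1 a2 a3 a4
    exact det_bounds hC hκ a3 (hp n) a2 (fun k => (hB1 n k).1) (hcl n a1).1 (hcl n a1).2 (hsum0 n a1) a4
  have hsV : Tendsto (fun n => s n - V n) atTop (𝓝 0) := by
    refine squeeze_zero_norm' (evB.mono fun n h => h.1) ?_
    exact ((hS.const_mul _).add_const 2).div_atTop hnat
  have hR : Tendsto R atTop (𝓝 0) := by
    refine squeeze_zero_norm' (evB.mono fun n h => h.2) ?_
    simpa using hS.const_mul (2 * C * M / κ)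
  have evV : ∀ᶠ n : ℕ in atTop, γ ^ 2 / 2 ≤ V n := by
    have h1 : Tendsto (fun n : ℕ => ((p n : ℝ) / n) * ((p n : ℝ) / n - 1 / n)) atTop (𝓝 (γ * (γ - 0))) :=
      hA.mul (hA.sub (tendsto_const_nhds.div_atTop hnat))
    have h2 : γ ^ 2 / 2 < γ * (γ - 0) := by nlinarith [hγ.1, mul_pos hγ.1 hγ.1]
    filter_upwards [h1.eventually (lt_mem_nhds h2)] with n h
    exact h.le.trans (Vn_lower (hp n))
  have evs : ∀ᶠ n : ℕ in atTop, γ ^ 2 / 4 ≤ s n := by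
    have h2 : -(γ ^ 2 / 4) < 0 := by have := hγ.1; simp; positivity
    filter_upwards [evV, hsV.eventually (lt_mem_nhds h2)] with n a b
    linarith
  have hg4 : 0 < γ ^ 2 / 4 := by have := hγ.1; positivity
  have hVs : Tendsto (fun n => V n / s n) atTop (𝓝 1) := by
    have h1 : Tendsto (fun n => (s n - V n) / s n) atTop (𝓝 0) := by
      have h2 : Tendsto (fun n => |s n - V n| / (γ ^ 2 / 4)) atTop (𝓝 0) := by
        simpa using hsV.abs.div_const (γ ^ 2 / 4)
      refine squeeze_zero_norm' ?_ h2
      filter_upwards [evs] with n h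
      rw [Real.norm_eq_abs, abs_div, abs_of_pos (hg4.trans_le h)]
      gcongr
    have h3 := h1.const_sub 1
    rw [sub_zero] at h3
    refine h3.congr' ?_
    filter_upwards [evs] with n h
    have : s n ≠ 0 := (hg4.trans_le h).ne'
    field_simp
    ring
  -- the characteristic functions
  have hchar : ∀ t : ℝ, Tendsto (fun n => ∫ ω, Complex.exp (((t / Real.sqrt (s n)) *
      (ldB (lam n) ω - muSeq n (p n) (A n) (lam n)) : ℝ) * Complex.I)
      ∂(Measure.pi fun _ : Fin (p n) => uniformSphere n)) atTop (𝓝 (Complex.exp (-(t : ℂ) ^ 2 / 2))) := by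
    intro t
    set τ : ℕ → ℝ := fun n => t / Real.sqrt (s n) with hτdef
    set T : ℝ := |t| / Real.sqrt (γ ^ 2 / 4) with hTdef
    have hsq4 : 0 < Real.sqrt (γ ^ 2 / 4) := Real.sqrt_pos.2 hg4
    have evτ : ∀ᶠ n in atTop, |τ n| ≤ T := by
      filter_upwards [evs] with n h
      simp only [hτdef, hTdef]
      rw [abs_div, abs_of_nonneg (Real.sqrt_nonneg _)]
      gcongr
    have hT0 : 0 ≤ T := by positivity
    have hτV : Tendsto (fun n => τ n ^ 2 * V n) atTop (𝓝 (t ^ 2)) := by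
      have h1 := hVs.const_mul (t ^ 2)
      rw [mul_one] at h1
      refine h1.congr' ?_
      filter_upwards [evs] with n h
      simp only [hτdef]
      rw [div_pow, Real.sq_sqrt (hg4.le.trans h)]
      ring
    have ev5 : ∀ᶠ n : ℕ in atTop, 4 * (T + 1) ≤ κ * n :=
      (hnat.const_mul_atTop hκ).eventually_ge_atTop _
    have hex : ∀ n, ∃ δ : ℂ, (|τ n| ≤ T ∧ κ * n ≤ (n : ℝ) - p n ∧ 4 * (T + 1) ≤ κ * n) →
        (‖δ‖ ≤ (32 * (T ^ 3 + T + T * (T + 1)) / κ ^ 2) / n ∧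
        ∏ j ∈ Finset.range (p n), chi (n - j) (τ n) / chi n (τ n) =
        Complex.exp (τ n * Ln n (p n) * Complex.I +
          (-τ n ^ 2 - τ n * Complex.I) * (Vn n (p n) / 2 : ℝ) + δ)) := by
      intro n
      by_cases h : (|τ n| ≤ T ∧ κ * n ≤ (n : ℝ) - p n ∧ 4 * (T + 1) ≤ κ * n)
      · obtain ⟨δ, hδ⟩ := prod_chi hκ (τ n) h.1 n (p n) (hp n) h.2.1 h.2.2
        exact ⟨δ, fun _ => hδ⟩
      · exact ⟨0, fun h' => absurd h' h⟩
    choose δ hδ using hex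
    have evδ : ∀ᶠ n : ℕ in atTop, |τ n| ≤ T ∧ κ * n ≤ (n : ℝ) - p n ∧ 4 * (T + 1) ≤ κ * n := by
      filter_upwards [evτ, ev2, ev5] with n a b d using ⟨a, b, d⟩
    have hδ0 : Tendsto δ atTop (𝓝 0) := by
      refine squeeze_zero_norm' (evδ.mono fun n h => (hδ n h).1) ?_
      exact tendsto_const_nhds.div_atTop hnat
    have hrest : Tendsto (fun n => τ n * ((s n - V n) / 2 - R n)) atTop (𝓝 0) := by
      have h2 : Tendsto (fun n => T * |(s n - V n) / 2 - R n|) atTop (𝓝 0) := by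
        have := (((hsV.div_const 2).sub hR).abs).const_mul T
        simpa using this
      refine squeeze_zero_norm' ?_ h2
      filter_upwards [evτ] with n h
      rw [Real.norm_eq_abs, abs_mul]
      gcongr
    have hmain : Tendsto (fun n => Complex.exp (-((τ n ^ 2 * V n : ℝ) : ℂ) / 2 +
        ((τ n * ((s n - V n) / 2 - R n) : ℝ) : ℂ) * Complex.I + δ n)) atTop
        (𝓝 (Complex.exp (-(t : ℂ) ^ 2 / 2))) := by
      have a1 := ((Complex.continuous_ofReal.tendsto _).comp hτV).neg.div_const 2
      have a2 := ((Complex.continuous_ofReal.tendsto _).comp hrest).mul_const Complex.I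
      have a3 := (Complex.continuous_exp.tendsto _).comp ((a1.add a2).add hδ0)
      simpa [Function.comp_def] using a3
    have hdiff : Tendsto (fun n => T * (C ^ 2 * S n + C * Real.sqrt (S n))) atTop (𝓝 0) := by
      have h1 : Tendsto (fun n => Real.sqrt (S n)) atTop (𝓝 0) := by
        simpa [Function.comp_def] using (Real.continuous_sqrt.tendsto 0).comp hS
      simpa using ((hS.const_mul (C ^ 2)).add (h1.const_mul C)).const_mul T
    refine tendsto_of_tendsto_of_dist hmain (squeeze_zero' (Eventually.of_forall fun _ => dist_nonneg) ?_ hdiff)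
    filter_upwards [ev1, ev3, evδ] with n a1 a3 aδ
    have h := cf_diff (hp n) hC0 (hcl n a1).1 (fun k => (hB1 n k).1) (hsum0 n a1) (τ n)
      (muSeq n (p n) (A n) (lam n))
    rw [dist_comm, dist_eq_norm]
    rw [(hδ n aδ).2, ← Complex.exp_add] at h
    have hmu := mu_eq (A n) (lam n) (hCi.trans_le (hcl n a1).1) a1 a3 (htr n a1)
    have e : (((τ n * (p n * Real.log (c n) - muSeq n (p n) (A n) (lam n)) : ℝ) : ℂ) * Complex.I +
        (τ n * Ln n (p n) * Complex.I +
          (-τ n ^ 2 - τ n * Complex.I) * (Vn n (p n) / 2 : ℝ) + δ n)) =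
        -((τ n ^ 2 * V n : ℝ) : ℂ) / 2 +
        ((τ n * ((s n - V n) / 2 - R n) : ℝ) : ℂ) * Complex.I + δ n := by
      rw [hmu]
      simp only [hVdef, hsdef, hRdef]
      push_cast
      ring
    rw [e] at h
    refine h.trans ?_
    have := aδ.1
    have h5 : 0 ≤ C ^ 2 * S n + C * Real.sqrt (S n) := by have := hS0 n; positivity
    exact mul_le_mul_of_nonneg_right this h5
  have hmeas : ∀ n, Measurable fun ω : Fin (p n) → Fin n → ℝ =>
      (ldB (lam n) ω - muSeq n (p n) (A n) (lam n)) / Real.sqrt (s n) := fun n =>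
    ((measurable_ldB _).sub_const _).div_const _
  let μ : ℕ → ProbabilityMeasure ℝ := fun n =>
    ⟨(Measure.pi fun _ : Fin (p n) => uniformSphere n).map fun ω =>
      (ldB (lam n) ω - muSeq n (p n) (A n) (lam n)) / Real.sqrt (s n),
      Measure.isProbabilityMeasure_map (hmeas n).aemeasurable⟩
  let μ₀ : ProbabilityMeasure ℝ := ⟨gaussianReal 0 1, inferInstance⟩
  have hconv : Tendsto μ atTop (𝓝 μ₀) := by
    refine ProbabilityMeasure.tendsto_of_tendsto_charFun fun t => ?_
    have e0 : charFun (μ₀ : Measure ℝ) t = Complex.exp (-(t : ℂ) ^ 2 / 2) := by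
      change charFun (gaussianReal 0 1) t = _
      rw [charFun_gaussianReal]
      congr 1
      simp
      ring
    rw [e0]
    refine (hchar t).congr fun n => ?_
    change _ = charFun (Measure.map _ _) t
    rw [charFun_apply_real, integral_map (hmeas n).aemeasurable (by fun_prop)]
    congr 1
    ext ω
    congr 2
    push_cast
    ring
  intro f
  have h := (ProbabilityMeasure.tendsto_iff_forall_integral_tendsto.1 hconv) f
  refine h.congr fun n => ?_
  change ∫ x, f x ∂(Measure.map _ _) = _
  rw [integral_map (hmeas n).aemeasurable f.continuous.aestronglyMeasurable]
  exact (integral_logDetYY (A n) (lam n) (hlam n) (fun k => hCi.trans_le (hB1 n k).1)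
    (fun x => f ((x - muSeq n (p n) (A n) (lam n)) / Real.sqrt (s n)))
    (f.continuous.measurable.comp ((measurable_id.sub_const _).div_const _))).symm
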